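/- arXiv:math/0302331 — 2 statements merged into one kernel-verified Lean document; each statement's English description precedes it below -/
import Mathlib

section
/- Let N ≥ 2 and let V ∈ L^∞_loc(ℝ^N∖{0}) ∩ L¹_loc(ℝ^N) be radial with ∫|∇u|² ≥ ∫Vu² for all radial u ∈ C_c^∞(ℝ^N), and assume 0 < θ := ess sup_x |x|² V(x) < ∞. Then for every u ∈ C_c^∞(ℝ^N), with u_0 its spherical average, ∫_{ℝ^N}|∇u|² − ∫_{ℝ^N}Vu² ≥ ∫_{ℝ^N}|∇u_0|² − ∫_{ℝ^N}Vu_0² + ((N−1)/(N−1+θ)) ∫_{ℝ^N}|∇(u−u_0)|² dx. -/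
open MeasureTheory Real

set_option linter.unusedSectionVars false

namespace ISD

section gauss
variable {E : Type*} [NormedAddCommGroup E] [InnerProductSpace ℝ E] [FiniteDimensional ℝ E]
  [MeasurableSpace E] [BorelSpace E]

/-- Gaussian density. -/
noncomputable def gd (x : E) : ℝ := Real.exp (-(1/2) * ‖x‖ ^ 2)

/-- Gaussian measure (not normalized). -/
noncomputable def gm (E : Type*) [NormedAddCommGroup E] [InnerProductSpace ℝ E]
    [FiniteDimensional ℝ E] [MeasurableSpace E] [BorelSpace E] : Measure E :=
  (volume : Measure E).withDensity (fun x => ENNReal.ofReal (gd x))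

lemma gd_pos (x : E) : 0 < gd x := Real.exp_pos _

lemma gd_cont : Continuous (gd : E → ℝ) := by unfold gd; fun_prop

lemma integrable_gm_iff {F : Type*} [NormedAddCommGroup F] [NormedSpace ℝ F] (f : E → F) :
    Integrable f (gm E) ↔ Integrable (fun x => gd x • f x) := by
  unfold gm
  rw [integrable_withDensity_iff_integrable_smul' (by exact (gd_cont.measurable.ennreal_ofReal)) (by simp)]
  simp [ENNReal.toReal_ofReal (gd_pos _).le]

lemma integral_gm {F : Type*} [NormedAddCommGroup F] [NormedSpace ℝ F] (f : E → F) :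
    ∫ x, f x ∂(gm E) = ∫ x, gd x • f x := by
  unfold gm
  rw [integral_withDensity_eq_integral_toReal_smul (by exact (gd_cont.measurable.ennreal_ofReal)) (by simp)]
  simp [ENNReal.toReal_ofReal (gd_pos _).le]

lemma integrable_norm_rpow_gm [Nontrivial E] {s : ℝ} (hs : 0 ≤ s) :
    Integrable (fun x : E => ‖x‖ ^ s) (gm E) := by
  rw [integrable_gm_iff]
  have := (integrable_fun_norm_addHaar (E := E) volume
    (f := fun r : ℝ => Real.exp (-(1/2) * r ^ 2) • r ^ s)).2 ?_
  · exact this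
  · have h := integrable_rpow_mul_exp_neg_mul_sq (b := 1/2) (by norm_num)
      (s := ((Module.finrank ℝ E - 1 : ℕ) : ℝ) + s) (by
        have : (0:ℝ) ≤ ((Module.finrank ℝ E - 1 : ℕ) : ℝ) := by positivity
        linarith)
    refine (h.integrableOn (s := Set.Ioi 0)).congr_fun ?_ measurableSet_Ioi
    intro r hr
    have hr : (0:ℝ) < r := hr
    simp only [smul_eq_mul]
    rw [Real.rpow_add hr, Real.rpow_natCast]
    ring

instance [Nontrivial E] : IsFiniteMeasure (gm E) := by
  have h := integrable_norm_rpow_gm (E := E) (s := 0) le_rfl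
  simp only [Real.rpow_zero] at h
  exact (integrable_const_iff_isFiniteMeasure one_ne_zero).1 h

lemma integrable_growth [Nontrivial E] (k : ℕ) : Integrable (fun x : E => (1 + ‖x‖) ^ k) (gm E) := by
  have h : Integrable (fun x : E => 2 ^ k * (1 + ‖x‖ ^ (k:ℝ))) (gm E) :=
    (((integrable_const 1).add (integrable_norm_rpow_gm (by positivity)))).const_mul _
  refine h.mono' (by fun_prop) (Filter.Eventually.of_forall fun x => ?_)
  have hx := norm_nonneg x
  rw [Real.norm_of_nonneg (by positivity), Real.rpow_natCast]
  rcases le_total ‖x‖ 1 with h1 | h1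
  · calc (1 + ‖x‖) ^ k ≤ 2 ^ k := by gcongr; linarith
      _ ≤ _ := by nlinarith [pow_nonneg hx k, pow_pos (two_pos (α := ℝ)) k]
  · calc (1 + ‖x‖) ^ k ≤ (2 * ‖x‖) ^ k := by gcongr; linarith
      _ ≤ _ := by rw [mul_pow]; nlinarith [pow_nonneg hx k, pow_pos (two_pos (α := ℝ)) k]

lemma integrable_of_growth [Nontrivial E] {F : Type*} [NormedAddCommGroup F]
    {f : E → F} (hf : AEStronglyMeasurable f (gm E)) (C : ℝ) (k : ℕ)
    (h : ∀ x, ‖f x‖ ≤ C * (1 + ‖x‖) ^ k) : Integrable f (gm E) :=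
  ((integrable_growth k).const_mul C).mono' hf (Filter.Eventually.of_forall h)

lemma integrable_of_growth_prod [Nontrivial E] {F : Type*} [NormedAddCommGroup F]
    {f : E × E → F} (hf : AEStronglyMeasurable f ((gm E).prod (gm E))) (C : ℝ) (k : ℕ)
    (h : ∀ x, ‖f x‖ ≤ C * ((1 + ‖x.1‖) ^ k * (1 + ‖x.2‖) ^ k)) :
    Integrable f ((gm E).prod (gm E)) :=
  ((Integrable.mul_prod (integrable_growth k) (integrable_growth k)).const_mul C).mono' hf
    (Filter.Eventually.of_forall h)

/-- rotation -/
noncomputable def rot (t : ℝ) (z : E × E) : E × E :=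
  (cos t • z.1 + sin t • z.2, cos t • z.2 - sin t • z.1)

lemma rot_cont (t : ℝ) : Continuous (rot t : E × E → E × E) := by unfold rot; fun_prop

lemma rot_rot_neg (t : ℝ) (z : E × E) : rot (-t) (rot t z) = z := by
  have := Real.sin_sq_add_cos_sq t
  ext
  · simp only [rot, Real.cos_neg, Real.sin_neg]
    rw [show cos t • (cos t • z.1 + sin t • z.2) + -sin t • (cos t • z.2 - sin t • z.1)
      = (sin t ^ 2 + cos t ^2) • z.1 by module, this, one_smul]
  · simp only [rot, Real.cos_neg, Real.sin_neg]
    rw [show cos t • (cos t • z.2 - sin t • z.1) - -sin t • (cos t • z.1 + sin t • z.2)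
      = (sin t ^ 2 + cos t ^2) • z.2 by module, this, one_smul]

lemma rot_norm (t : ℝ) (z : E × E) :
    ‖(rot t z).1‖ ^ 2 + ‖(rot t z).2‖ ^ 2 = ‖z.1‖ ^ 2 + ‖z.2‖ ^ 2 := by
  have := Real.sin_sq_add_cos_sq t
  simp only [rot]
  rw [norm_add_sq_real, norm_sub_sq_real]
  simp only [norm_smul, inner_smul_left, inner_smul_right, mul_pow, Real.norm_eq_abs, sq_abs]
  rw [real_inner_comm z.1 z.2]
  simp
  linear_combination (‖z.1‖^2 + ‖z.2‖^2) * this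

/-- rotation as isometry -/
noncomputable def rotI (t : ℝ) : WithLp 2 (E × E) ≃ₗᵢ[ℝ] WithLp 2 (E × E) where
  toFun z := WithLp.toLp 2 (rot t (WithLp.ofLp z))
  invFun z := WithLp.toLp 2 (rot (-t) (WithLp.ofLp z))
  map_add' x y := by
    apply (WithLp.ofLp_injective 2)
    ext <;> simp [rot] <;> module
  map_smul' c x := by
    apply (WithLp.ofLp_injective 2)
    ext <;> simp [rot] <;> module
  left_inv z := by simp [rot_rot_neg]
  right_inv z := by
    have := rot_rot_neg (-t) z.ofLp
    rw [neg_neg] at this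
    simp [this]
  norm_map' z := by
    have h := rot_norm t z.ofLp
    rw [← sq_eq_sq₀ (norm_nonneg _) (norm_nonneg _), WithLp.prod_norm_sq_eq_of_L2,
      WithLp.prod_norm_sq_eq_of_L2]
    exact h

lemma rot_mp_vol (t : ℝ) : MeasurePreserving (rot t : E × E → E × E) := by
  have := ((WithLp.volume_preserving_ofLp E E).comp (rotI (E := E) t).measurePreserving).comp
    (WithLp.volume_preserving_toLp E E)
  exact this

lemma rot_mp [Nontrivial E] (t : ℝ) :
    MeasurePreserving (rot t : E × E → E × E) ((gm E).prod (gm E)) ((gm E).prod (gm E)) := by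
  have hm : Measurable (fun x : E => ENNReal.ofReal (gd x)) := gd_cont.measurable.ennreal_ofReal
  have hp : (gm E).prod (gm E) = (volume : Measure (E × E)).withDensity
      (fun z => ENNReal.ofReal (gd z.1) * ENNReal.ofReal (gd z.2)) := by
    unfold gm
    rw [prod_withDensity hm hm]; rfl
  refine ⟨(rot_cont t).measurable, ?_⟩
  rw [hp]
  ext s hs
  rw [Measure.map_apply (rot_cont t).measurable hs,
    withDensity_apply _ hs, withDensity_apply _ ((rot_cont t).measurable hs)]
  rw [← (rot_mp_vol t).setLIntegral_comp_preimage hs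
    (f := fun z => ENNReal.ofReal (gd z.1) * ENNReal.ofReal (gd z.2)) ((hm.comp measurable_fst).mul (hm.comp measurable_snd))]
  congr 1
  ext z
  rw [← ENNReal.ofReal_mul (gd_pos _).le, ← ENNReal.ofReal_mul (gd_pos _).le]
  congr 1
  unfold gd
  rw [← Real.exp_add, ← Real.exp_add, ← mul_add, ← mul_add, rot_norm]

lemma gauss_ibp [Nontrivial E] {f : E → ℝ} (hf : Differentiable ℝ f) (C : ℝ) (k : ℕ)
    (h1 : ∀ x, ‖f x‖ ≤ C * (1 + ‖x‖) ^ k) (h2 : ∀ x, ‖fderiv ℝ f x‖ ≤ C * (1 + ‖x‖) ^ k) (v : E) :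
    ∫ x, f x * inner ℝ v x ∂(gm E) = ∫ x, fderiv ℝ f x v ∂(gm E) := by
  have hg : ∀ x : E, HasFDerivAt (gd : E → ℝ) (-(gd x) • innerSL ℝ x) x := by
    intro x
    have h := ((hasStrictFDerivAt_norm_sq x).hasFDerivAt.const_mul (-(1/2:ℝ))).exp
    refine HasFDerivAt.congr_fderiv h (ContinuousLinearMap.ext fun y => ?_)
    simp [gd]
  have hC : ∀ x : E, 0 ≤ C * (1 + ‖x‖) ^ k := fun x => (norm_nonneg _).trans (h1 x)
  have i1 : Integrable f (gm E) := integrable_of_growth hf.continuous.aestronglyMeasurable C k h1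
  have i2 : Integrable (fun x => fderiv ℝ f x v) (gm E) := by
    refine integrable_of_growth (measurable_fderiv_apply_const ℝ f v).aestronglyMeasurable
      (C * ‖v‖) k fun x => ?_
    calc _ ≤ ‖fderiv ℝ f x‖ * ‖v‖ := ContinuousLinearMap.le_opNorm _ _
      _ ≤ (C * (1 + ‖x‖) ^ k) * ‖v‖ := by gcongr; exact h2 x
      _ = _ := by ring
  have i3 : Integrable (fun x => f x * inner ℝ v x) (gm E) := by
    refine integrable_of_growth (hf.continuous.mul (by fun_prop)).aestronglyMeasurable
      (C * ‖v‖) (k+1) fun x => ?_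
    rw [norm_mul]
    calc _ ≤ (C * (1 + ‖x‖) ^ k) * (‖v‖ * (1 + ‖x‖)) := by
          gcongr
          · exact hC x
          · exact h1 x
          · exact (norm_inner_le_norm v x).trans (by gcongr; linarith)
      _ = _ := by ring
  have key := integral_mul_fderiv_eq_neg_fderiv_mul_of_integrable (μ := (volume : Measure E))
    (f := f) (g := gd) (v := v) ?_ ?_ ?_ (fun x _ => hf x) (fun x _ => (hg x).differentiableAt)
  · rw [integral_gm, integral_gm]
    simp only [smul_eq_mul]
    rw [← neg_inj, ← integral_neg, ]
    convert key using 1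
    · congr 1; ext x
      rw [(hg x).fderiv]
      simp [real_inner_comm v x]; ring
    · congr 2; ext x; ring
  · have := (integrable_gm_iff _).1 i2
    refine this.congr (Filter.Eventually.of_forall fun x => ?_)
    simp [mul_comm]
  · have := ((integrable_gm_iff _).1 i3).neg
    refine this.congr (Filter.Eventually.of_forall fun x => ?_)
    simp only [(hg x).fderiv, Pi.neg_apply]
    simp [real_inner_comm v x]; ring
  · have := (integrable_gm_iff _).1 i1
    refine this.congr (Filter.Eventually.of_forall fun x => ?_)
    simp [mul_comm]

end gauss
end ISD

namespace ISD

section gauss2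
variable {E : Type*} [NormedAddCommGroup E] [InnerProductSpace ℝ E] [FiniteDimensional ℝ E]
  [MeasurableSpace E] [BorelSpace E]

lemma norm_grad (F : E → ℝ) (x : E) : ‖gradient F x‖ = ‖fderiv ℝ F x‖ := by
  rw [← toDual_gradient, LinearIsometryEquiv.norm_map]

lemma inner_grad (F : E → ℝ) (x v : E) : inner ℝ (gradient F x) v = fderiv ℝ F x v := by
  rw [← toDual_gradient]; simp

lemma meas_grad (F : E → ℝ) : Measurable (gradient F) := by
  have : gradient F = fun x => (InnerProductSpace.toDual ℝ E).symm (fderiv ℝ F x) := rfl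
  rw [this]
  exact (InnerProductSpace.toDual ℝ E).symm.continuous.measurable.comp (measurable_fderiv ℝ F)

lemma rot_int [Nontrivial E] (t : ℝ) {f : E × E → ℝ} (hf : Measurable f) :
    ∫ z, f (rot t z) ∂((gm E).prod (gm E)) = ∫ z, f z ∂((gm E).prod (gm E)) := by
  conv_rhs => rw [← (rot_mp t).map_eq]
  rw [integral_map (rot_cont t).measurable.aemeasurable hf.aestronglyMeasurable]

lemma rot_bd1 (t : ℝ) (z : E × E) : 1 + ‖(rot t z).1‖ ≤ (1 + ‖z.1‖) * (1 + ‖z.2‖) := by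
  have : ‖(rot t z).1‖ ≤ ‖z.1‖ + ‖z.2‖ := by
    simp only [rot]
    refine (norm_add_le _ _).trans ?_
    rw [norm_smul, norm_smul, Real.norm_eq_abs, Real.norm_eq_abs]
    nlinarith [abs_cos_le_one t, abs_sin_le_one t, norm_nonneg z.1, norm_nonneg z.2]
  nlinarith [norm_nonneg z.1, norm_nonneg z.2]

lemma rot_bd2 (t : ℝ) (z : E × E) : ‖(rot t z).2‖ ≤ (1 + ‖z.1‖) * (1 + ‖z.2‖) := by
  have : ‖(rot t z).2‖ ≤ ‖z.1‖ + ‖z.2‖ := by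
    simp only [rot]
    refine (norm_sub_le _ _).trans ?_
    rw [norm_smul, norm_smul, Real.norm_eq_abs, Real.norm_eq_abs]
    nlinarith [abs_cos_le_one t, abs_sin_le_one t, norm_nonneg z.1, norm_nonneg z.2]
  nlinarith [norm_nonneg z.1, norm_nonneg z.2]

lemma rot_hasDeriv (t : ℝ) (z : E × E) : HasDerivAt (fun s => (rot s z).1) ((rot t z).2) t := by
  simp only [rot]
  have := ((hasDerivAt_cos t).smul_const z.1).add ((hasDerivAt_sin t).smul_const z.2)
  refine this.congr_deriv ?_
  module

lemma gauss_poincare [Nontrivial E] {F : E → ℝ} (hF : Differentiable ℝ F) (C : ℝ)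
    (h1 : ∀ x, ‖F x‖ ≤ C * (1 + ‖x‖) ^ 2) (h2 : ∀ x, ‖gradient F x‖ ≤ C * (1 + ‖x‖) ^ 2)
    (h0 : ∫ x, F x ∂(gm E) = 0) :
    ∫ x, F x ^ 2 ∂(gm E) ≤ ∫ x, ‖gradient F x‖ ^ 2 ∂(gm E) := by
  set γ := gm E with hγ
  have hFm : Measurable F := hF.continuous.measurable
  have hGm := meas_grad F
  have hrm : ∀ t, Measurable (rot t : E × E → E × E) := fun t => (rot_cont t).measurable
  have hC : 0 ≤ C := by
    have := (norm_nonneg _).trans (h1 0)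
    simpa using this
  set p : E × E → ℝ := fun z => (1 + ‖z.1‖) * (1 + ‖z.2‖) with hp
  have hp1 : ∀ z, 1 ≤ p z := fun z => by
    simp only [hp]; nlinarith [norm_nonneg z.1, norm_nonneg z.2]
  have hp0 : ∀ z, 0 ≤ p z := fun z => by linarith [hp1 z]
  have hz1 : ∀ z : E × E, 1 + ‖z.1‖ ≤ p z := fun z => by
    simp only [hp]; nlinarith [norm_nonneg z.1, norm_nonneg z.2]
  have hz2 : ∀ z : E × E, ‖z.2‖ ≤ p z := fun z => by
    simp only [hp]; nlinarith [norm_nonneg z.1, norm_nonneg z.2]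
  have bF1 : ∀ z : E × E, ‖F z.1‖ ≤ C * p z ^ 2 := fun z => (h1 _).trans (by
    have := hz1 z; gcongr)
  have bG1 : ∀ z : E × E, ‖gradient F z.1‖ ≤ C * p z ^ 2 := fun z => (h2 _).trans (by
    have := hz1 z; gcongr)
  have bFr : ∀ t (z : E × E), ‖F (rot t z).1‖ ≤ C * p z ^ 2 := fun t z => (h1 _).trans (by
    have := rot_bd1 t z; gcongr)
  have bGr : ∀ t (z : E × E), ‖gradient F (rot t z).1‖ ≤ C * p z ^ 2 := fun t z => (h2 _).trans (by
    have := rot_bd1 t z; gcongr)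
  have intp : ∀ (C : ℝ) (k : ℕ), Integrable (fun z => C * p z ^ k) (γ.prod γ) := by
    intro C k
    refine ((Integrable.mul_prod (integrable_growth k) (integrable_growth k)).const_mul C).congr ?_
    exact Filter.Eventually.of_forall fun z => by simp only [hp, mul_pow]
  set h : ℝ → ℝ := fun t => ∫ z, F z.1 * F (rot t z).1 ∂(γ.prod γ) with hh
  have hF1m : Measurable (fun z : E × E => F z.1) := hFm.comp measurable_fst
  have hFrm : ∀ t, Measurable (fun z : E × E => F (rot t z).1) := fun t =>
    hFm.comp (measurable_fst.comp (hrm t))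
  have hGrm : ∀ t, Measurable (fun z : E × E => gradient F (rot t z).1) := fun t =>
    hGm.comp (measurable_fst.comp (hrm t))
  have hder : ∀ t, HasDerivAt h
      (∫ z, F z.1 * inner ℝ (gradient F (rot t z).1) (rot t z).2 ∂(γ.prod γ)) t := by
    intro t
    refine (hasDerivAt_integral_of_dominated_loc_of_deriv_le (s := Set.univ)
      (F := fun t z => F z.1 * F (rot t z).1)
      (bound := fun z => C ^ 2 * p z ^ 5) Filter.univ_mem
      (Filter.Eventually.of_forall fun s => (hF1m.mul (hFrm s)).aestronglyMeasurable)
      ?_ (F' := fun t z => F z.1 * inner ℝ (gradient F (rot t z).1) (rot t z).2)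
      (hF1m.mul ((hGrm t).inner (measurable_snd.comp (hrm t)))).aestronglyMeasurable
      ?_ (intp _ _) ?_).2
    · refine (intp (C^2) 4).mono' (hF1m.mul (hFrm t)).aestronglyMeasurable
        (Filter.Eventually.of_forall fun z => ?_)
      rw [norm_mul]
      calc _ ≤ (C * p z ^ 2) * (C * p z ^ 2) := by gcongr; exacts [bF1 z, bFr t z]
        _ = _ := by ring
    · refine Filter.Eventually.of_forall fun z s _ => ?_
      rw [norm_mul]
      calc _ ≤ (C * p z ^ 2) * ((C * p z ^ 2) * p z) := by
            refine mul_le_mul (bF1 z) ?_ (norm_nonneg _) (by have := hp0 z; positivity)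
            refine (norm_inner_le_norm _ _).trans ?_
            have := hp0 z
            exact mul_le_mul (bGr s z) (rot_bd2 s z) (norm_nonneg _) (by positivity)
        _ = _ := by ring
    · refine Filter.Eventually.of_forall fun z s _ => ?_
      refine HasDerivAt.const_mul (F z.1) ?_
      rw [inner_grad]
      exact (hF _).hasFDerivAt.comp_hasDerivAt s (rot_hasDeriv s z)
  set D := ∫ x, ‖gradient F x‖ ^ 2 ∂γ with hD
  set Z := γ.real Set.univ with hZ
  have hsq1 : Integrable (fun z : E × E => ‖gradient F z.1‖ ^ 2) (γ.prod γ) := by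
    refine (intp (C^2) 4).mono' ((hGm.comp measurable_fst).norm.pow_const 2).aestronglyMeasurable
        (Filter.Eventually.of_forall fun z => ?_)
    rw [norm_pow, norm_norm]
    calc _ ≤ (C * p z ^ 2) ^ 2 := by gcongr; exact bG1 z
      _ = _ := by ring
  have hsqr : ∀ t, Integrable (fun z : E × E => ‖gradient F (rot t z).1‖ ^ 2) (γ.prod γ) := by
    intro t
    refine (intp (C^2) 4).mono' ((hGrm t).norm.pow_const 2).aestronglyMeasurable
        (Filter.Eventually.of_forall fun z => ?_)
    rw [norm_pow, norm_norm]
    calc _ ≤ (C * p z ^ 2) ^ 2 := by gcongr; exact bGr t z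
      _ = _ := by ring
  have hI1 : ∫ z, ‖gradient F z.1‖ ^ 2 ∂(γ.prod γ) = Z * D := by
    rw [integral_fun_fst (fun x => ‖gradient F x‖ ^ 2)]; rfl
  have hIr : ∀ t, ∫ z, ‖gradient F (rot t z).1‖ ^ 2 ∂(γ.prod γ) = Z * D := by
    intro t
    rw [← hI1]
    exact rot_int t (f := fun z => ‖gradient F z.1‖ ^ 2)
      ((hGm.comp measurable_fst).norm.pow_const 2)
  have hInt0 : ∀ t, Integrable (fun z : E × E => inner ℝ (gradient F (rot (-t) z).1)
      (gradient F z.1)) (γ.prod γ) := by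
    intro t
    refine (intp (C^2) 4).mono' ((hGrm (-t)).inner (hGm.comp measurable_fst)).aestronglyMeasurable
      (Filter.Eventually.of_forall fun z => ?_)
    refine (norm_inner_le_norm _ _).trans ?_
    have := hp0 z
    calc _ ≤ (C * p z ^ 2) * (C * p z ^ 2) := by gcongr; exacts [bGr _ z, bG1 z]
      _ = _ := by ring
  have hder2 : ∀ t, ∫ z, F z.1 * inner ℝ (gradient F (rot t z).1) (rot t z).2 ∂(γ.prod γ)
      = - sin t * ∫ z, inner ℝ (gradient F (rot (-t) z).1) (gradient F z.1) ∂(γ.prod γ) := by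
    intro t
    have e1 := rot_int t (f := fun z : E × E => F (rot (-t) z).1 * inner ℝ (gradient F z.1) z.2)
      ((hFrm _).mul ((hGm.comp measurable_fst).inner measurable_snd))
    simp only [rot_rot_neg] at e1
    rw [e1, integral_prod, integral_prod, ← integral_const_mul]
    · congr 1; ext a
      rw [← integral_const_mul]
      have hlin : ∀ b : E, HasFDerivAt (fun b : E => (rot (-t) (a, b)).1)
          (sin (-t) • ContinuousLinearMap.id ℝ E) b := by
        intro b
        simp only [rot]
        exact (((hasFDerivAt_id b).const_smul (sin (-t))).const_add _)
      have hd : ∀ b, HasFDerivAt (fun b : E => F (rot (-t) (a, b)).1)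
          ((fderiv ℝ F (rot (-t) (a, b)).1).comp (sin (-t) • ContinuousLinearMap.id ℝ E)) b :=
        fun b => (hF _).hasFDerivAt.comp b (hlin b)
      have := gauss_ibp (f := fun b : E => F (rot (-t) (a, b)).1)
        (fun b => (hd b).differentiableAt) (C * (1 + ‖a‖) ^ 2) 2 ?_ ?_ (gradient F a)
      · rw [this]
        congr 1; ext b
        rw [(hd b).fderiv, inner_grad]
        simp
      · intro b
        refine (bFr (-t) (a, b)).trans (le_of_eq ?_)
        simp only [hp]; ring
      · intro b
        rw [(hd b).fderiv]
        refine (ContinuousLinearMap.opNorm_comp_le _ _).trans ?_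
        have : ‖sin (-t) • ContinuousLinearMap.id ℝ E‖ ≤ 1 := by
          rw [norm_smul, ContinuousLinearMap.norm_id, mul_one]
          exact abs_sin_le_one _
        rw [← norm_grad]
        calc _ ≤ C * p (a, b) ^ 2 * 1 := by
              have := hp0 (a,b)
              gcongr
              exact bGr _ _
          _ = _ := by simp only [hp]; ring
    · exact hInt0 t
    · refine (intp (C^2) 5).mono' ((hFrm _).mul
        ((hGm.comp measurable_fst).inner measurable_snd)).aestronglyMeasurable
        (Filter.Eventually.of_forall fun z => ?_)
      rw [norm_mul]
      calc _ ≤ (C * p z ^ 2) * ((C * p z ^ 2) * p z) := by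
            refine mul_le_mul (bFr _ z) ?_ (norm_nonneg _) (by have := hp0 z; positivity)
            refine (norm_inner_le_norm _ _).trans ?_
            have := hp0 z
            exact mul_le_mul (bG1 z) (hz2 z) (norm_nonneg _) (by positivity)
        _ = _ := by ring
  have hle : ∀ t, ∫ z, inner ℝ (gradient F (rot (-t) z).1) (gradient F z.1) ∂(γ.prod γ) ≤ Z * D := by
    intro t
    have : ∫ z, (‖gradient F (rot (-t) z).1‖ ^ 2 / 2 + ‖gradient F z.1‖ ^ 2 / 2) ∂(γ.prod γ) = Z * D := by
      rw [integral_add ((hsqr _).div_const 2) (hsq1.div_const 2), integral_div, integral_div, hIr, hI1]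
      ring
    rw [← this]
    refine integral_mono (hInt0 t) (((hsqr _).div_const 2).add (hsq1.div_const 2)) fun z => ?_
    have h := real_inner_le_norm (gradient F (rot (-t) z).1) (gradient F z.1)
    have h' := sq_nonneg (‖gradient F (rot (-t) z).1‖ - ‖gradient F z.1‖)
    show inner ℝ (gradient F (rot (-t) z).1) (gradient F z.1)
      ≤ ‖gradient F (rot (-t) z).1‖ ^ 2 / 2 + ‖gradient F z.1‖ ^ 2 / 2
    nlinarith
  have hkd : ∀ t, HasDerivAt (fun t => h t - cos t * (Z * D))
      (- sin t * (∫ z, inner ℝ (gradient F (rot (-t) z).1) (gradient F z.1) ∂(γ.prod γ))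
        - (- sin t) * (Z * D)) t := by
    intro t
    have := hder t
    rw [hder2 t] at this
    exact this.sub ((hasDerivAt_cos t).mul_const _)
  have hmono : MonotoneOn (fun t => h t - cos t * (Z * D)) (Set.Icc 0 (π/2)) := by
    refine monotoneOn_of_deriv_nonneg (convex_Icc _ _)
      (fun t _ => (hkd t).continuousAt.continuousWithinAt)
      (fun t _ => (hkd t).differentiableAt.differentiableWithinAt) fun t ht => ?_
    rw [interior_Icc] at ht
    rw [(hkd t).deriv]
    have hs : 0 ≤ sin t := sin_nonneg_of_nonneg_of_le_pi ht.1.le (by linarith [ht.2, pi_pos])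
    nlinarith [hle t]
  have hfin := hmono (Set.left_mem_Icc.2 (by positivity)) (Set.right_mem_Icc.2 (by positivity))
    (by positivity)
  have hh0 : h 0 = Z * ∫ x, F x ^ 2 ∂γ := by
    have : h 0 = ∫ z : E × E, F z.1 ^ 2 ∂(γ.prod γ) := by
      simp only [hh, rot]
      congr 1; ext z; simp [sq]
    rw [this, integral_fun_fst (fun x => F x ^ 2)]; rfl
  have hh1 : h (π/2) = 0 := by
    have : h (π/2) = ∫ z : E × E, F z.1 * F z.2 ∂(γ.prod γ) := by
      simp only [hh, rot]
      congr 1; ext z; simp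
    rw [this, integral_prod_mul, h0, zero_mul]
  simp only [hh0, hh1, cos_zero, cos_pi_div_two] at hfin
  have hZpos : 0 < Z := by
    have : γ ≠ 0 := by
      intro h
      have e : ∫ x : E, (1:ℝ) ∂γ = 0 := by rw [h]; simp
      rw [hγ, integral_gm] at e
      have i : Integrable (fun x : E => gd x • (1:ℝ)) := (integrable_gm_iff _).1 (integrable_const _)
      have := (integral_eq_zero_iff_of_nonneg (fun x => by simp [(gd_pos x).le]) i).1 e
      have hae : ∀ᵐ x : E, False := this.mono fun x hx => by
        simp at hx; exact (gd_pos x).ne' hx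
      simp at hae
      exact NeZero.ne (volume : Measure E) hae
    have : NeZero γ := ⟨this⟩
    exact measureReal_univ_pos
  nlinarith

end gauss2
end ISD

namespace ISD

section polar
variable {E : Type*} [NormedAddCommGroup E] [InnerProductSpace ℝ E] [FiniteDimensional ℝ E]
  [MeasurableSpace E] [BorelSpace E]

/-- sphere measure -/
noncomputable abbrev sg (E : Type*) [NormedAddCommGroup E] [InnerProductSpace ℝ E]
    [FiniteDimensional ℝ E] [MeasurableSpace E] [BorelSpace E] : Measure (Metric.sphere (0 : E) 1) :=
  (volume : Measure E).toSphere

/-- radial measure -/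
noncomputable abbrev rm (E : Type*) [NormedAddCommGroup E] [InnerProductSpace ℝ E] :
    Measure (Set.Ioi (0:ℝ)) := Measure.volumeIoiPow (Module.finrank ℝ E - 1)

lemma polar_mp : MeasurePreserving (homeomorphUnitSphereProd E)
    (volume.comap (Subtype.val)) ((sg E).prod (rm E)) :=
  (volume : Measure E).measurePreserving_homeomorphUnitSphereProd

lemma polar_integral [Nontrivial E] (f : E → ℝ) :
    ∫ x, f x = ∫ p, f (p.2.1 • p.1.1) ∂((sg E).prod (rm E)) := by
  have h1 : ∫ x, f x = ∫ x : ({(0)}ᶜ : Set E), f x.1 ∂(Measure.comap Subtype.val volume) := by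
      rw [integral_subtype_comap (measurableSet_singleton _).compl fun x ↦ f x,
        restrict_compl_singleton]
  rw [h1]
  · · rw [← polar_mp.integral_comp (Homeomorph.measurableEmbedding _)]
      congr 1; ext x
      congr 1
      have := congrArg Subtype.val ((homeomorphUnitSphereProd E).symm_apply_apply x)
      rw [homeomorphUnitSphereProd_symm_apply_coe] at this
      exact this.symm

lemma polar_integrable [Nontrivial E] (f : E → ℝ) :
    Integrable f ↔ Integrable (fun p => f (p.2.1 • p.1.1)) ((sg E).prod (rm E)) := by
  rw [← polar_mp.integrable_comp_emb (Homeomorph.measurableEmbedding _)]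
  have : ((fun p : Metric.sphere (0 : E) 1 × Set.Ioi (0:ℝ) => f (p.2.1 • p.1.1)) ∘
      (homeomorphUnitSphereProd E)) = f ∘ Subtype.val := by
    ext x
    have := congrArg Subtype.val ((homeomorphUnitSphereProd E).symm_apply_apply x)
    rw [homeomorphUnitSphereProd_symm_apply_coe] at this
    simp only [Function.comp]
    rw [this]
  rw [this, ← integrableOn_iff_comap_subtypeVal (measurableSet_singleton _).compl, IntegrableOn,
    restrict_compl_singleton]

lemma integral_rm (f : ℝ → ℝ) :
    ∫ r : Set.Ioi (0:ℝ), f r ∂(rm E) = ∫ r in Set.Ioi (0:ℝ), r ^ (Module.finrank ℝ E - 1) * f r := by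
  simp only [rm, Measure.volumeIoiPow, ENNReal.ofReal]
  rw [integral_withDensity_eq_integral_smul,
    integral_subtype_comap measurableSet_Ioi
      fun a ↦ Real.toNNReal (a ^ (Module.finrank ℝ E - 1)) • f a,
    setIntegral_congr_fun measurableSet_Ioi fun x hx ↦ ?_]
  · simp only [NNReal.smul_def, smul_eq_mul]
    rw [Real.coe_toNNReal _ (pow_nonneg (le_of_lt hx) _)]
  · exact (measurable_subtype_coe.pow_const _).real_toNNReal

lemma radial_moment [Nontrivial E] (s : ℝ) (hs : 0 ≤ s) :
    0 < ∫ r : Set.Ioi (0:ℝ), Real.exp (-(1/2) * r.1 ^ 2) * r.1 ^ s ∂(rm E) ∧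
    ∫ r : Set.Ioi (0:ℝ), Real.exp (-(1/2) * r.1 ^ 2) * r.1 ^ (s + 2) ∂(rm E) =
    (Module.finrank ℝ E + s) * ∫ r : Set.Ioi (0:ℝ), Real.exp (-(1/2) * r.1 ^ 2) * r.1 ^ s ∂(rm E) := by
  have hd : 1 ≤ Module.finrank ℝ E := Module.finrank_pos
  have key : ∀ s : ℝ, 0 ≤ s → ∫ r : Set.Ioi (0:ℝ), Real.exp (-(1/2) * r.1 ^ 2) * r.1 ^ s ∂(rm E) =
      (1/2:ℝ) ^ (-((Module.finrank ℝ E + s) / 2)) * (1/2) * Real.Gamma ((Module.finrank ℝ E + s) / 2) := by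
    intro s hs
    rw [integral_rm (fun r => Real.exp (-(1/2) * r ^ 2) * r ^ s)]
    have := integral_rpow_mul_exp_neg_mul_rpow (p := 2) (q := (Module.finrank ℝ E - 1 : ℕ) + s)
      (b := 1/2) (by norm_num) (by
        have : (0:ℝ) ≤ ((Module.finrank ℝ E - 1 : ℕ) : ℝ) := by positivity
        linarith) (by norm_num)
    rw [show ((Module.finrank ℝ E - 1 : ℕ) : ℝ) + s + 1 = Module.finrank ℝ E + s by
      push_cast [hd]; ring] at this
    rw [neg_div] at this
    rw [← this]
    refine setIntegral_congr_fun measurableSet_Ioi fun r hr => ?_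
    have hr : (0:ℝ) < r := hr
    rw [Real.rpow_add hr, Real.rpow_natCast, Real.rpow_two]
    ring
  have hd' : (1:ℝ) ≤ Module.finrank ℝ E := by exact_mod_cast hd
  have hpos : 0 < ((Module.finrank ℝ E + s) / 2) := by linarith
  constructor
  · rw [key s hs]
    have := Real.Gamma_pos_of_pos hpos
    positivity
  · rw [key s hs, key (s+2) (by linarith)]
    rw [show ((Module.finrank ℝ E:ℝ) + (s+2)) / 2 = (Module.finrank ℝ E + s) / 2 + 1 by ring,
      Real.Gamma_add_one hpos.ne', neg_add, Real.rpow_add (by norm_num), Real.rpow_neg_one]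
    ring

lemma hasFDerivAt_norm' {x : E} (hx : x ≠ 0) :
    HasFDerivAt (fun y : E => ‖y‖) (innerSL ℝ (‖x‖⁻¹ • x)) x := by
  have hn : ‖x‖ ≠ 0 := norm_ne_zero_iff.2 hx
  have h := (hasStrictFDerivAt_norm_sq x).hasFDerivAt.sqrt (by positivity)
  have e : (fun y : E => √(‖y‖ ^ 2)) = fun y => ‖y‖ := by ext y; simp
  rw [e] at h
  refine h.congr_fderiv (ContinuousLinearMap.ext fun y => ?_)
  simp
  field_simp

/-- the homogeneous extension and its gradient -/
lemma homog_grad {f : E → ℝ} (hf : Differentiable ℝ f) (ε : ℝ) {x : E} (hx : x ≠ 0) :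
    HasGradientAt (fun y : E => ‖y‖ ^ (1 + ε) * f (‖y‖⁻¹ • y))
      (‖x‖ ^ ε • (((1 + ε) * f (‖x‖⁻¹ • x)) • (‖x‖⁻¹ • x) + (gradient f (‖x‖⁻¹ • x) -
        inner ℝ (gradient f (‖x‖⁻¹ • x)) (‖x‖⁻¹ • x) • (‖x‖⁻¹ • x)))) x := by
  have hn : 0 < ‖x‖ := norm_pos_iff.2 hx
  rw [hasGradientAt_iff_hasFDerivAt]
  have h1 := (hasFDerivAt_norm' hx).rpow_const (p := 1 + ε) (Or.inl hn.ne')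
  have h2 : HasFDerivAt (fun y : E => ‖y‖⁻¹ • y) (‖x‖⁻¹ • ContinuousLinearMap.id ℝ E +
      (-(‖x‖ ^ 2)⁻¹ • (innerSL ℝ) (‖x‖⁻¹ • x)).smulRight x) x :=
    ((hasDerivAt_inv hn.ne').comp_hasFDerivAt x (hasFDerivAt_norm' hx)).smul (hasFDerivAt_id x)
  have h3 : HasFDerivAt (fun y : E => f (‖y‖⁻¹ • y)) _ x :=
    HasFDerivAt.comp (g := f) x (hf (‖x‖⁻¹ • x)).hasFDerivAt h2
  refine (h1.mul h3).congr_fderiv (ContinuousLinearMap.ext fun y => ?_)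
  simp only [InnerProductSpace.toDual_apply_apply]
  simp [inner_smul_left, inner_add_left, inner_sub_left, Real.rpow_add hn,
    smul_smul]
  field_simp
  ring
end polar
end ISD

namespace ISD

section sph
variable {E : Type*} [NormedAddCommGroup E] [InnerProductSpace ℝ E] [FiniteDimensional ℝ E]
  [MeasurableSpace E] [BorelSpace E]

lemma pol_norm (p : Metric.sphere (0 : E) 1 × Set.Ioi (0:ℝ)) : ‖p.2.1 • p.1.1‖ = p.2.1 := by
  rw [norm_smul, Real.norm_of_nonneg (le_of_lt p.2.2)]
  simp

lemma pol_dir (p : Metric.sphere (0 : E) 1 × Set.Ioi (0:ℝ)) :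
    ‖p.2.1 • p.1.1‖⁻¹ • (p.2.1 • p.1.1) = p.1.1 := by
  rw [pol_norm, smul_smul, inv_mul_cancel₀ (ne_of_gt p.2.2), one_smul]

lemma pol_ne (p : Metric.sphere (0 : E) 1 × Set.Ioi (0:ℝ)) : p.2.1 • p.1.1 ≠ 0 := by
  rw [← norm_pos_iff, pol_norm]; exact p.2.2

lemma gm_sep [Nontrivial E] {f : E → ℝ} (a : E → ℝ) (s : ℝ)
    (h : ∀ x : E, x ≠ 0 → f x = ‖x‖ ^ s * a (‖x‖⁻¹ • x)) :
    ∫ x, f x ∂(gm E) = (∫ ω, a ω.1 ∂(sg E)) *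
      ∫ r : Set.Ioi (0:ℝ), Real.exp (-(1/2) * r.1 ^ 2) * r.1 ^ s ∂(rm E) := by
  rw [integral_gm, polar_integral, ← integral_prod_mul]
  congr 1; ext p
  rw [h _ (pol_ne p), pol_dir, gd, pol_norm, smul_eq_mul]
  ring

lemma grad_cont {f : E → ℝ} (hf : ContDiff ℝ 1 f) : Continuous (gradient f) :=
  (InnerProductSpace.toDual ℝ E).symm.continuous.comp (hf.continuous_fderiv one_ne_zero)

/-- tangential gradient squared -/
noncomputable def tg (f : E → ℝ) (ω : E) : ℝ :=
  ‖gradient f ω‖ ^ 2 - (inner ℝ (gradient f ω) ω) ^ 2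

lemma sphere_poincare [Nontrivial E] {f : E → ℝ} (hf : ContDiff ℝ 1 f)
    (h0 : ∫ ω, f ω.1 ∂(sg E) = 0) :
    ((Module.finrank ℝ E : ℝ) - 1) * ∫ ω, f ω.1 ^ 2 ∂(sg E) ≤ ∫ ω, tg f ω.1 ∂(sg E) := by
  have hfd : Differentiable ℝ f := hf.differentiable one_ne_zero
  have hgc := grad_cont hf
  obtain ⟨M1, hM1⟩ := (isCompact_sphere (0:E) 1).exists_bound_of_continuousOn hf.continuous.continuousOn
  obtain ⟨M2, hM2⟩ := (isCompact_sphere (0:E) 1).exists_bound_of_continuousOn hgc.continuousOn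
  have isph : ∀ g : E → ℝ, Continuous g → Integrable (fun ω : Metric.sphere (0:E) 1 => g ω.1) (sg E) :=
    fun g hg => (hg.comp continuous_subtype_val).integrable_of_hasCompactSupport
      (HasCompactSupport.of_compactSpace _)
  have key : ∀ ε : ℝ, 0 < ε → ε < 1 → ((Module.finrank ℝ E : ℝ) - 1 - ε ^ 2) * ∫ ω, f ω.1 ^ 2 ∂(sg E)
      ≤ ∫ ω, tg f ω.1 ∂(sg E) := by
    intro ε hε hε1
    set F : E → ℝ := fun y => ‖y‖ ^ (1 + ε) * f (‖y‖⁻¹ • y) with hFdef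
    have hdir : ∀ x : E, x ≠ 0 → ‖x‖⁻¹ • x ∈ Metric.sphere (0:E) 1 := fun x hx => by
      simp [norm_smul, hx]
    obtain ⟨x₀, hx₀⟩ := exists_ne (0:E)
    have hM10 : 0 ≤ M1 := (norm_nonneg _).trans (hM1 _ (hdir x₀ hx₀))
    have hM20 : 0 ≤ M2 := (norm_nonneg _).trans (hM2 _ (hdir x₀ hx₀))
    have hFb : ∀ x, ‖F x‖ ≤ M1 * ‖x‖ ^ (1 + ε) := by
      intro x
      by_cases hx : x = 0
      · simp [hFdef, hx, Real.zero_rpow (by positivity : 1 + ε ≠ 0)]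
      · simp only [hFdef]
        rw [norm_mul, Real.norm_of_nonneg (by positivity), mul_comm]
        gcongr
        exact hM1 _ (hdir x hx)
    have hF0 : HasGradientAt F 0 0 := by
      rw [hasGradientAt_iff_hasFDerivAt, map_zero, hasFDerivAt_iff_isLittleO_nhds_zero]
      have e0 : F 0 = 0 := by simp [hFdef, Real.zero_rpow (by positivity : 1 + ε ≠ 0)]
      simp only [zero_add, e0, sub_zero, zero_apply]
      have hO : F =O[nhds 0] fun x => ‖x‖ ^ (1 + ε) := by
        refine Asymptotics.IsBigO.of_bound M1 (Filter.Eventually.of_forall fun x => ?_)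
        rw [Real.norm_of_nonneg (by positivity : 0 ≤ ‖x‖ ^ (1+ε))]
        exact hFb x
      refine hO.trans_isLittleO ?_
      rw [← Asymptotics.isLittleO_norm_right]
      refine Asymptotics.IsLittleO.of_bound fun c hc => ?_
      have ht : Filter.Tendsto (fun x : E => ‖x‖ ^ ε) (nhds 0) (nhds 0) := by
        have : Continuous (fun x : E => ‖x‖ ^ ε) :=
          (Real.continuous_rpow_const hε.le).comp continuous_norm
        have h := this.tendsto 0
        simpa [Real.zero_rpow hε.ne'] using h
      filter_upwards [ht.eventually (ge_mem_nhds hc)] with x hx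
      rw [Real.norm_of_nonneg (by positivity), norm_norm]
      rw [Real.rpow_add' (norm_nonneg x) (by positivity), Real.rpow_one, mul_comm]
      gcongr
    have hFg : ∀ x : E, x ≠ 0 → gradient F x = _ := fun x hx => (homog_grad hfd ε hx).gradient
    have hFd : Differentiable ℝ F := by
      intro x
      by_cases hx : x = 0
      · rw [hx]; exact hF0.differentiableAt
      · exact (homog_grad hfd ε hx).differentiableAt
    have hpw : ∀ x : E, ∀ s : ℝ, 0 ≤ s → s ≤ 2 → ‖x‖ ^ s ≤ (1 + ‖x‖) ^ 2 := by
      intro x s hs hs2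
      have hx := norm_nonneg x
      calc ‖x‖ ^ s ≤ (1 + ‖x‖) ^ s := by gcongr; linarith
        _ ≤ (1 + ‖x‖) ^ (2:ℝ) := Real.rpow_le_rpow_of_exponent_le (by linarith) hs2
        _ = _ := by norm_num
    have hP := gauss_poincare (F := F) hFd (2 * M1 + 2 * M2) ?_ ?_ ?_
    · rw [gm_sep (f := fun x => F x ^ 2) (fun ω => f ω ^ 2) (2 * ε + 2),
        gm_sep (f := fun x => ‖gradient F x‖ ^ 2) (fun ω => (1 + ε) ^ 2 * f ω ^ 2 + tg f ω) (2 * ε)] at hP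
      · obtain ⟨hI, hI2⟩ := radial_moment (E := E) (2 * ε) (by positivity)
        rw [hI2, integral_add ((isph (fun ω => f ω ^ 2) (hf.continuous.pow 2)).const_mul _)
          (isph (tg f) (by unfold tg; fun_prop)), integral_const_mul] at hP
        set I := ∫ r : Set.Ioi (0:ℝ), Real.exp (-(1/2) * r.1 ^ 2) * r.1 ^ (2 * ε) ∂(rm E)
        rw [← mul_assoc] at hP
        have := le_of_mul_le_mul_right hP hI
        nlinarith
      · intro x hx
        rw [hFg x hx]
        set ω := ‖x‖⁻¹ • x with hω
        have hω1 : ‖ω‖ = 1 := by simpa using hdir x hx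
        clear_value ω
        rw [norm_smul, mul_pow, Real.norm_of_nonneg (by positivity)]
        congr 1
        · rw [← Real.rpow_natCast, ← Real.rpow_mul (norm_nonneg _)]
          congr 1; push_cast; ring
        · rw [norm_add_sq_real, norm_sub_sq_real, tg, norm_smul, norm_smul, hω1]
          simp only [inner_smul_left, inner_smul_right, inner_sub_right]
          rw [real_inner_self_eq_norm_sq, hω1, real_inner_comm ω (gradient f ω)]
          simp [mul_pow]
          ring
      · intro x hx
        simp only [hFdef]
        rw [mul_pow, ← Real.rpow_natCast (‖x‖ ^ (1+ε)), ← Real.rpow_mul (norm_nonneg _)]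
        congr 2; push_cast; ring
    · intro x
      refine (hFb x).trans ?_
      have := hpw x (1+ε) (by linarith) (by linarith)
      nlinarith [sq_nonneg (1 + ‖x‖)]
    · intro x
      by_cases hx : x = 0
      · rw [hx, hF0.gradient, norm_zero]; positivity
      · rw [hFg x hx, norm_smul, Real.norm_of_nonneg (by positivity), mul_comm]
        have h1 := hM1 _ (hdir x hx)
        have h2 := hM2 _ (hdir x hx)
        set ω := ‖x‖⁻¹ • x with hω
        have hω1 : ‖ω‖ = 1 := by simpa using hdir x hx
        clear_value ω
        refine mul_le_mul ?_ (hpw x ε hε.le (by linarith)) (by positivity) (by positivity)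
        refine (norm_add_le _ _).trans (add_le_add ?_ ((norm_sub_le _ _).trans ?_))
        · rw [norm_smul, hω1, mul_one, norm_mul, Real.norm_of_nonneg (by positivity)]
          gcongr
          linarith
        · have h3 := norm_inner_le_norm (𝕜 := ℝ) (gradient f ω) ω
          rw [norm_smul, hω1]
          rw [hω1] at h3
          linarith
    · rw [gm_sep (f := F) f (1 + ε) (fun x _ => rfl), h0, zero_mul]
  have hlim : Filter.Tendsto (fun ε : ℝ => ((Module.finrank ℝ E : ℝ) - 1 - ε ^ 2) *
      ∫ ω, f ω.1 ^ 2 ∂(sg E)) (nhdsWithin 0 (Set.Ioi 0))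
      (nhds (((Module.finrank ℝ E : ℝ) - 1) * ∫ ω, f ω.1 ^ 2 ∂(sg E))) := by
    have : Continuous (fun ε : ℝ => ((Module.finrank ℝ E : ℝ) - 1 - ε ^ 2) *
      ∫ ω, f ω.1 ^ 2 ∂(sg E)) := by fun_prop
    have h := (this.tendsto 0).mono_left (nhdsWithin_le_nhds (s := Set.Ioi 0))
    simpa using h
  refine le_of_tendsto hlim ?_
  filter_upwards [Ioo_mem_nhdsGT (zero_lt_one (α := ℝ))] with ε hε
  exact key ε hε.1 hε.2

end sph
end ISD

namespace ISD

section hardy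
variable {E : Type*} [NormedAddCommGroup E] [InnerProductSpace ℝ E] [FiniteDimensional ℝ E]
  [MeasurableSpace E] [BorelSpace E]

open Filter Topology

lemma hardy_lim [Nontrivial E] {V : E → ℝ} (hV : LocallyIntegrable V) {f g : ℕ → ℝ → ℝ} {F G : ℝ → ℝ}
    {M R : ℝ} (hfc : ∀ n, Continuous (f n)) (hgc : ∀ n, Continuous (g n))
    (hfM : ∀ n r, 0 ≤ r → |f n r| ≤ M) (hgM : ∀ n r, 0 ≤ r → |g n r| ≤ M)
    (hfR : ∀ n r, R ≤ r → f n r = 0) (hgR : ∀ n r, R ≤ r → g n r = 0)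
    (hf : ∀ r, 0 < r → Tendsto (fun n => f n r) atTop (𝓝 (F r)))
    (hg : ∀ r, 0 < r → Tendsto (fun n => g n r) atTop (𝓝 (G r)))
    (h : ∀ n, ∫ x : E, V x * f n ‖x‖ ^ 2 ≤ ∫ x : E, g n ‖x‖ ^ 2) :
    ∫ x : E, V x * F ‖x‖ ^ 2 ≤ ∫ x : E, G ‖x‖ ^ 2 := by
  have hne : ∀ᵐ x : E, x ≠ 0 := by
    simp [ae_iff]
  have hM : 0 ≤ M := (abs_nonneg _).trans (hfM 0 0 le_rfl)
  have hsq : ∀ t : ℝ, |t| ≤ M → t ^ 2 ≤ M ^ 2 := fun t ht => by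
    rw [← sq_abs]; gcongr
  refine le_of_tendsto_of_tendsto (b := atTop) ?_ ?_ (Eventually.of_forall h)
  · refine tendsto_integral_of_dominated_convergence
      ((Metric.closedBall (0:E) R).indicator fun x => |V x| * M ^ 2) ?_ ?_ ?_ ?_
    · intro n
      exact hV.aestronglyMeasurable.mul
        (((hfc n).comp continuous_norm).pow 2).aestronglyMeasurable
    · rw [integrable_indicator_iff Metric.isClosed_closedBall.measurableSet]
      exact ((hV.integrableOn_isCompact (isCompact_closedBall _ _)).abs).mul_const _
    · intro n
      refine Eventually.of_forall fun x => ?_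
      by_cases hx : ‖x‖ ≤ R
      · rw [Set.indicator_of_mem (by simpa using hx), Real.norm_eq_abs, abs_mul, abs_of_nonneg (sq_nonneg (f n ‖x‖))]
        exact mul_le_mul_of_nonneg_left (hsq _ (hfM n _ (norm_nonneg _))) (abs_nonneg _)
      · rw [Set.indicator_of_notMem (by simpa using hx), hfR n _ (le_of_not_ge hx)]; simp
    · filter_upwards [hne] with x hx
      exact ((hf _ (norm_pos_iff.2 hx)).pow 2).const_mul _
  · refine tendsto_integral_of_dominated_convergence
      ((Metric.closedBall (0:E) R).indicator fun x => M ^ 2) ?_ ?_ ?_ ?_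
    · intro n
      exact (((hgc n).comp continuous_norm).pow 2).aestronglyMeasurable
    · rw [integrable_indicator_iff Metric.isClosed_closedBall.measurableSet]
      exact continuousOn_const.integrableOn_compact (isCompact_closedBall _ _)
    · intro n
      refine Eventually.of_forall fun x => ?_
      by_cases hx : ‖x‖ ≤ R
      · rw [Set.indicator_of_mem (by simpa using hx), Real.norm_eq_abs, abs_of_nonneg (sq_nonneg _)]
        exact (hsq _ (hgM n _ (norm_nonneg _)))
      · rw [Set.indicator_of_notMem (by simpa using hx), hgR n _ (le_of_not_ge hx)]; simp
    · filter_upwards [hne] with x hx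
      exact ((hg _ (norm_pos_iff.2 hx)).pow 2)

lemma rad_smooth {φ : ℝ → ℝ} {a : ℝ} (ha : 0 < a) (hφ : ContDiff ℝ (⊤ : ℕ∞) φ)
    (h0 : ∀ r, r ≤ a → φ r = 0) : ContDiff ℝ (⊤ : ℕ∞) (fun x : E => φ ‖x‖) := by
  rw [contDiff_iff_contDiffAt]
  intro x
  by_cases hx : x = 0
  · subst hx
    have : (fun x : E => φ ‖x‖) =ᶠ[𝓝 0] fun _ => 0 := by
      filter_upwards [Metric.ball_mem_nhds (0:E) ha] with y hy
      exact h0 _ (by simpa using (mem_ball_zero_iff.1 hy).le)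
    exact contDiffAt_const.congr_of_eventuallyEq this
  · exact hφ.contDiffAt.comp x (contDiffAt_norm ℝ hx)

lemma rad_supp {φ : ℝ → ℝ} {b : ℝ} (h0 : ∀ r, b ≤ r → φ r = 0) :
    HasCompactSupport (fun x : E => φ ‖x‖) := by
  refine HasCompactSupport.intro (isCompact_closedBall (0:E) b) fun x hx => ?_
  exact h0 _ (by simpa using (by simpa using hx : b < ‖x‖).le)

lemma rad_hasFDeriv {φ : ℝ → ℝ} {x : E} (hx : x ≠ 0) (hφ : DifferentiableAt ℝ φ ‖x‖) :
    HasFDerivAt (fun y : E => φ ‖y‖) (deriv φ ‖x‖ • innerSL ℝ (‖x‖⁻¹ • x)) x :=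
  hφ.hasDerivAt.comp_hasFDerivAt x (hasFDerivAt_norm' hx)

lemma rad_grad {φ : ℝ → ℝ} {x : E} (hx : x ≠ 0) (hφ : DifferentiableAt ℝ φ ‖x‖) :
    gradient (fun y : E => φ ‖y‖) x = deriv φ ‖x‖ • (‖x‖⁻¹ • x) := by
  refine ext_inner_right ℝ fun v => ?_
  rw [inner_grad, (rad_hasFDeriv hx hφ).fderiv]
  simp [inner_smul_left]

lemma rad_grad_sq {φ : ℝ → ℝ} {x : E} (hx : x ≠ 0) (hφ : DifferentiableAt ℝ φ ‖x‖) :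
    ‖gradient (fun y : E => φ ‖y‖) x‖ ^ 2 = deriv φ ‖x‖ ^ 2 := by
  rw [rad_grad hx hφ, norm_smul, norm_smul, norm_inv, norm_norm,
    inv_mul_cancel₀ (norm_ne_zero_iff.2 hx), mul_one, Real.norm_eq_abs, sq_abs]

/-- the radial Hardy hypothesis -/
def RH (V : E → ℝ) : Prop := ∀ u : E → ℝ,
      ContDiff ℝ (⊤ : ℕ∞) u → HasCompactSupport u →
      (∀ x y : E, ‖x‖ = ‖y‖ → u x = u y) →
      (∫ x, V x * u x ^ 2) ≤ ∫ x, ‖gradient u x‖ ^ 2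

lemma hardy0 [Nontrivial E] {V : E → ℝ} (hR : RH V) {φ : ℝ → ℝ} {a b : ℝ} (ha : 0 < a)
    (hφ : ContDiff ℝ (⊤ : ℕ∞) φ)
    (h0 : ∀ r, r ≤ a → φ r = 0) (h1 : ∀ r, b ≤ r → φ r = 0) :
    ∫ x : E, V x * φ ‖x‖ ^ 2 ≤ ∫ x : E, deriv φ ‖x‖ ^ 2 := by
  have hne : ∀ᵐ x : E, x ≠ 0 := by
    simp [ae_iff]
  refine (hR _ (rad_smooth ha hφ h0) (rad_supp h1) (fun x y h => by simp only [h])).trans_eq ?_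
  refine integral_congr_ae ?_
  filter_upwards [hne] with x hx
  exact rad_grad_sq hx (hφ.differentiable (by simp) _)

open scoped Convolution in
lemma hardy1 [Nontrivial E] {V : E → ℝ} (hV : LocallyIntegrable V) (hR : RH V) {ψ : ℝ → ℝ} {a b : ℝ}
    (ha : 0 < a)
    (hψ : ContDiff ℝ 1 ψ)
    (h0 : ∀ r, r ≤ a → ψ r = 0) (h1 : ∀ r, b ≤ r → ψ r = 0) :
    ∫ x : E, V x * ψ ‖x‖ ^ 2 ≤ ∫ x : E, deriv ψ ‖x‖ ^ 2 := by
  let ρ : ℕ → ContDiffBump (0:ℝ) := fun n =>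
    ⟨a / (4 * ((n:ℝ) + 1)), a / (2 * ((n:ℝ) + 1)), by positivity, by
      apply div_lt_div_of_pos_left ha (by positivity); nlinarith [(n.cast_nonneg : (0:ℝ) ≤ n)]⟩
  have hρle : ∀ n, (ρ n).rOut ≤ a / 2 := fun n => by
    change a / (2 * ((n:ℝ) + 1)) ≤ a / 2
    apply div_le_div_of_nonneg_left ha.le (by positivity)
    nlinarith [(n.cast_nonneg : (0:ℝ) ≤ n)]
  have hρ0 : Tendsto (fun n => (ρ n).rOut) atTop (𝓝 0) := by
    have : Tendsto (fun n : ℕ => (a / 2) * (1 / ((n:ℝ) + 1))) atTop (𝓝 ((a/2) * 0)) :=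
      tendsto_one_div_add_atTop_nhds_zero_nat.const_mul _
    rw [mul_zero] at this
    refine this.congr fun n => ?_
    change _ = a / (2 * ((n:ℝ) + 1))
    field_simp
  have hψs : HasCompactSupport ψ := by
    refine HasCompactSupport.intro (isCompact_Icc (a := a) (b := b)) fun x hx => ?_
    rw [Set.mem_Icc, not_and_or, not_le, not_le] at hx
    exact hx.elim (fun h => h0 _ h.le) (fun h => h1 _ h.le)
  have hd0 : ∀ r, r < a → deriv ψ r = 0 := fun r hr => by
    have : ψ =ᶠ[𝓝 r] fun _ => 0 := by
      filter_upwards [Iio_mem_nhds hr] with y hy using h0 y (le_of_lt hy)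
    rw [this.deriv_eq]; simp
  have hd1 : ∀ r, b < r → deriv ψ r = 0 := fun r hr => by
    have : ψ =ᶠ[𝓝 r] fun _ => 0 := by
      filter_upwards [Ioi_mem_nhds hr] with y hy using h1 y (le_of_lt hy)
    rw [this.deriv_eq]; simp
  have hdc : Continuous (deriv ψ) := hψ.continuous_deriv le_rfl
  have hds : HasCompactSupport (deriv ψ) := hψs.deriv
  obtain ⟨M₁, hM₁⟩ := hψs.exists_bound_of_continuous hψ.continuous
  obtain ⟨M₂, hM₂⟩ := hds.exists_bound_of_continuous hdc
  let f : ℕ → ℝ → ℝ := fun n => ((ρ n).normed volume ⋆[ContinuousLinearMap.lsmul ℝ ℝ, volume] ψ)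
  let g : ℕ → ℝ → ℝ := fun n => ((ρ n).normed volume ⋆[ContinuousLinearMap.lsmul ℝ ℝ, volume] (deriv ψ))
  have hbd : ∀ (q : ℝ → ℝ) (hq : Continuous q) (M : ℝ) (hM : ∀ r, ‖q r‖ ≤ M) n r,
      |((ρ n).normed volume ⋆[ContinuousLinearMap.lsmul ℝ ℝ, volume] q) r| ≤ 3 * M := by
    intro q hq M hM n r
    have h := ContDiffBump.dist_normed_convolution_le (φ := ρ n) (μ := volume) (x₀ := r) (ε := 2 * M)
      hq.aestronglyMeasurable (fun x _ => by
        have := norm_sub_le (q x) (q r)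
        rw [dist_eq_norm]; linarith [hM x, hM r])
    rw [dist_eq_norm] at h
    have h2 := norm_sub_norm_le (((ρ n).normed volume ⋆[ContinuousLinearMap.lsmul ℝ ℝ, volume] q) r) (q r)
    rw [← Real.norm_eq_abs]
    linarith [hM r]
  have hz : ∀ (q : ℝ → ℝ) n r, (∀ s, |s - r| < a / 2 → q s = 0) →
      ((ρ n).normed volume ⋆[ContinuousLinearMap.lsmul ℝ ℝ, volume] q) r = 0 := by
    intro q n r h
    have h' : ∀ x ∈ Metric.ball r (ρ n).rOut, q x = q r := fun x hx => by
      rw [h x, h r (by simpa using ha)]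
      exact (Metric.mem_ball.1 hx).trans_le (hρle n)
    rw [ContDiffBump.normed_convolution_eq_right h', h r (by simpa using ha)]
  have hfs : ∀ n, ContDiff ℝ (⊤ : ℕ∞) (f n) := fun n =>
    (ρ n).hasCompactSupport_normed.contDiff_convolution_left _ (ρ n).contDiff_normed
      hψ.continuous.locallyIntegrable
  have hfd : ∀ n, deriv (f n) = g n := fun n => funext fun r =>
    (hψs.hasDerivAt_convolution_right (ContinuousLinearMap.lsmul ℝ ℝ)
      ((ρ n).continuous_normed.locallyIntegrable (μ := volume)) hψ r).deriv
  refine hardy_lim hV (f := f) (g := g) (M := max (3 * M₁) (3 * M₂)) (R := b + a)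
    (fun n => (hfs n).continuous) (fun n => ?_)
    (fun n r _ => (hbd _ hψ.continuous _ hM₁ n r).trans (le_max_left _ _))
    (fun n r _ => (hbd _ hdc _ hM₂ n r).trans (le_max_right _ _)) ?_ ?_
    (fun r _ => ContDiffBump.convolution_tendsto_right_of_continuous hρ0 hψ.continuous r)
    (fun r _ => ContDiffBump.convolution_tendsto_right_of_continuous hρ0 hdc r) (fun n => ?_)
  · rw [← hfd]; exact (hfs n).continuous_deriv (by simp)
  · intro n r hr
    refine hz _ n r fun s hs => h1 _ ?_
    rw [abs_lt] at hs; linarith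
  · intro n r hr
    refine hz _ n r fun s hs => hd1 _ ?_
    rw [abs_lt] at hs; linarith
  · rw [← hfd]
    refine hardy0 (a := a / 2) (b := b + a) hR (by positivity) (hfs n) ?_ ?_
    · intro r hr
      refine hz _ n r fun s hs => h0 _ ?_
      rw [abs_lt] at hs; linarith
    · intro r hr
      refine hz _ n r fun s hs => h1 _ ?_
      rw [abs_lt] at hs; linarith

lemma hardy2 [Nontrivial E] {V : E → ℝ} (hV : LocallyIntegrable V) (hR : RH V) {φ : ℝ → ℝ} {b : ℝ}
    (hφ : ContDiff ℝ 1 φ) (hφ0 : φ 0 = 0) (h1 : ∀ r, b ≤ r → φ r = 0) :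
    ∫ x : E, V x * φ ‖x‖ ^ 2 ≤ ∫ x : E, deriv φ ‖x‖ ^ 2 := by
  have hsd : ContDiff ℝ 1 Real.smoothTransition := Real.smoothTransition.contDiff
  have hsc : Continuous (deriv Real.smoothTransition) := hsd.continuous_deriv le_rfl
  have hdc : Continuous (deriv φ) := hφ.continuous_deriv le_rfl
  have hs0 : ∀ t, t < 0 → deriv Real.smoothTransition t = 0 := fun t ht => by
    have : Real.smoothTransition =ᶠ[𝓝 t] fun _ => 0 := by
      filter_upwards [Iio_mem_nhds ht] with y hy using Real.smoothTransition.zero_of_nonpos (le_of_lt hy)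
    rw [this.deriv_eq]; simp
  have hs1 : ∀ t, 1 < t → deriv Real.smoothTransition t = 0 := fun t ht => by
    have : Real.smoothTransition =ᶠ[𝓝 t] fun _ => 1 := by
      filter_upwards [Ioi_mem_nhds ht] with y hy using Real.smoothTransition.one_of_one_le (le_of_lt hy)
    rw [this.deriv_eq]; simp
  obtain ⟨K, hK⟩ := (isCompact_Icc (a := (0:ℝ)) (b := 1)).exists_bound_of_continuousOn hsc.continuousOn
  set B := max b 0 with hB
  have h1B : ∀ r, B ≤ r → φ r = 0 := fun r hr => h1 r ((le_max_left _ _).trans hr)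
  obtain ⟨L, hL⟩ := (isCompact_Icc (a := (0:ℝ)) (b := B + 1)).exists_bound_of_continuousOn hdc.continuousOn
  have hd1 : ∀ r, B < r → deriv φ r = 0 := fun r hr => by
    have : φ =ᶠ[𝓝 r] fun _ => 0 := by
      filter_upwards [Ioi_mem_nhds hr] with y hy using h1B y (le_of_lt hy)
    rw [this.deriv_eq]; simp
  have hB0 : 0 ≤ B := le_max_right _ _
  have hK0 : 0 ≤ K := (norm_nonneg _).trans (hK 0 (by simp))
  have hL0 : 0 ≤ L := (norm_nonneg _).trans (hL 0 ⟨le_rfl, by linarith⟩)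
  have hL' : ∀ r, 0 ≤ r → |deriv φ r| ≤ L := fun r hr => by
    by_cases h : r ≤ B + 1
    · exact hL r ⟨hr, h⟩
    · rw [hd1 r (by linarith)]; simpa using hL0
  have hφL : ∀ r, 0 ≤ r → |φ r| ≤ L * r := fun r hr => by
    have := (convex_Ici (0:ℝ)).norm_image_sub_le_of_norm_deriv_le (f := φ) (C := L) (x := 0) (y := r)
      (fun x _ => hφ.differentiable (by simp) x) (fun x hx => hL' x hx) (Set.self_mem_Ici) hr
    simpa [hφ0, abs_of_nonneg hr] using this
  have hφM : ∀ r, 0 ≤ r → |φ r| ≤ L * B := fun r hr => by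
    by_cases h : r ≤ B
    · exact (hφL r hr).trans (by gcongr)
    · rw [h1B r (by linarith)]; simpa using by positivity
  let χ : ℕ → ℝ → ℝ := fun n r => Real.smoothTransition (((n:ℝ) + 1) * r - 1)
  let χ' : ℕ → ℝ → ℝ := fun n r => deriv Real.smoothTransition (((n:ℝ) + 1) * r - 1) * ((n:ℝ) + 1)
  have hχ : ∀ n, ContDiff ℝ 1 (χ n) := fun n => hsd.comp (by fun_prop)
  have hχd : ∀ n r, HasDerivAt (χ n) (χ' n r) r := fun n r => by
    have h := (((hasDerivAt_id r).const_mul ((n:ℝ) + 1)).sub_const 1)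
    rw [mul_one] at h
    exact HasDerivAt.comp r ((hsd.differentiable (by simp) _).hasDerivAt) h
  have hprod : ∀ n r, HasDerivAt (fun r => χ n r * φ r) (χ' n r * φ r + χ n r * deriv φ r) r := fun n r =>
    (hχd n r).mul ((hφ.differentiable (by simp) r).hasDerivAt)
  have hχ1 : ∀ n r, |χ n r| ≤ 1 := fun n r => by
    rw [abs_of_nonneg (Real.smoothTransition.nonneg _)]; exact Real.smoothTransition.le_one _
  have hχφ : ∀ n r, 0 ≤ r → |χ' n r * φ r| ≤ 2 * K * L := fun n r hr => by
    have hn : (0:ℝ) < (n:ℝ) + 1 := by positivity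
    by_cases h : ((n:ℝ) + 1) * r - 1 ∈ Set.Icc (0:ℝ) 1
    · have h1 := hK _ h
      have h2 := hφL r hr
      rw [Real.norm_eq_abs] at h1
      simp only [χ']
      rw [abs_mul, abs_mul, abs_of_pos hn]
      calc _ ≤ K * ((n:ℝ) + 1) * (L * r) := by gcongr
        _ = K * L * (((n:ℝ) + 1) * r) := by ring
        _ ≤ K * L * 2 := by gcongr; linarith [h.2]
        _ = _ := by ring
    · rw [Set.mem_Icc, not_and_or, not_le, not_le] at h
      have : χ' n r = 0 := by
        simp only [χ']
        rw [h.elim (hs0 _) (hs1 _), zero_mul]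
      rw [this, zero_mul, abs_zero]; positivity
  have hev : ∀ r : ℝ, 0 < r → ∀ᶠ n : ℕ in atTop, 1 < ((n:ℝ) + 1) * r - 1 := fun r hr => by
    obtain ⟨m, hm⟩ := exists_nat_gt (2 / r)
    filter_upwards [eventually_ge_atTop m] with n hn
    have : (m:ℝ) ≤ n := by exact_mod_cast hn
    rw [div_lt_iff₀ hr] at hm
    nlinarith
  refine hardy_lim hV (f := fun n r => χ n r * φ r) (g := fun n r => χ' n r * φ r + χ n r * deriv φ r)
    (M := max (L * B) (2 * K * L + L)) (R := B + 1) ?_ ?_ ?_ ?_ ?_ ?_ ?_ ?_ ?_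
  · intro n; exact (hχ n).continuous.mul hφ.continuous
  · intro n
    refine Continuous.add (Continuous.mul ?_ hφ.continuous) ((hχ n).continuous.mul hdc)
    exact (hsc.comp (by fun_prop)).mul continuous_const
  · intro n r hr
    refine le_trans ?_ (le_max_left _ _)
    rw [abs_mul]
    exact (mul_le_of_le_one_left (abs_nonneg _) (hχ1 n r)).trans (hφM r hr)
  · intro n r hr
    refine le_trans ?_ (le_max_right _ _)
    refine (abs_add_le _ _).trans (add_le_add (hχφ n r hr) ?_)
    rw [abs_mul]
    exact (mul_le_of_le_one_left (abs_nonneg _) (hχ1 n r)).trans (hL' r hr)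
  · intro n r hr
    rw [h1B r (by linarith), mul_zero]
  · intro n r hr
    rw [h1B r (by linarith), hd1 r (by linarith)]; simp
  · intro r hr
    refine Tendsto.congr' ?_ tendsto_const_nhds
    filter_upwards [hev r hr] with n hn
    simp only [χ]
    rw [Real.smoothTransition.one_of_one_le hn.le, one_mul]
  · intro r hr
    refine Tendsto.congr' ?_ tendsto_const_nhds
    filter_upwards [hev r hr] with n hn
    simp only [χ, χ']
    rw [Real.smoothTransition.one_of_one_le hn.le, hs1 _ hn]; ring
  · intro n
    have hn : (0:ℝ) < (n:ℝ) + 1 := by positivity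
    have h := hardy1 (E := E) hV hR (ψ := fun r => χ n r * φ r) (a := 1 / ((n:ℝ) + 1)) (b := B)
      (by positivity) ((hχ n).mul hφ) ?_ ?_
    · simp only [fun r => (hprod n r).deriv] at h
      exact h
    · intro r hr
      simp only [χ]
      rw [Real.smoothTransition.zero_of_nonpos, zero_mul]
      rw [le_div_iff₀ hn] at hr
      linarith
    · intro r hr
      rw [h1B r hr, mul_zero]

end hardy
end ISD

namespace ISD

section mean
variable {E : Type*} [NormedAddCommGroup E] [InnerProductSpace ℝ E] [FiniteDimensional ℝ E]
  [MeasurableSpace E] [BorelSpace E]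

open Filter Topology

lemma sg_pos [Nontrivial E] : 0 < (sg E).real Set.univ := by
  have : Nonempty (Metric.sphere (0:E) 1) := (NormedSpace.sphere_nonempty.2 zero_le_one).to_subtype
  have h : 0 < (sg E) Set.univ := isOpen_univ.measure_pos (sg E) Set.univ_nonempty
  exact ENNReal.toReal_pos h.ne' (measure_ne_top _ _)

lemma rad_int [Nontrivial E] (h : ℝ → ℝ) :
    ∫ x : E, h ‖x‖ = (sg E).real Set.univ * ∫ r : Set.Ioi (0:ℝ), h r ∂(rm E) := by
  rw [polar_integral]
  simp only [pol_norm]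
  rw [integral_fun_snd (μ := sg E) (ν := rm E) (fun r : Set.Ioi (0:ℝ) => h r), smul_eq_mul]

lemma sph_int {g : E → ℝ} (hg : Continuous g) : Integrable (fun ω : Metric.sphere (0:E) 1 => g ω.1) (sg E) :=
  (hg.comp continuous_subtype_val).integrable_of_hasCompactSupport (HasCompactSupport.of_compactSpace _)

/-- spherical mean -/
noncomputable def mn (w : E → ℝ) (r : ℝ) : ℝ := ∫ ω, w (r • ω.1) ∂(sg E)

lemma mn_cont {w : E → ℝ} (hw : Continuous w) : Continuous (mn w) := by
  have h := continuous_parametric_integral_of_continuous (μ := sg E)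
    (f := fun (r : ℝ) (ω : Metric.sphere (0:E) 1) => w (r • ω.1))
    (by
      simp only [Function.uncurry_def]
      exact hw.comp (continuous_fst.smul (continuous_subtype_val.comp continuous_snd)))
    (isCompact_univ)
  simp only [Measure.restrict_univ] at h
  exact h

lemma orth [Nontrivial E] {p g : E → ℝ} (hp : ∀ x y : E, ‖x‖ = ‖y‖ → p x = p y)
    (hg : ∀ r : ℝ, 0 < r → ∫ ω, g (r • ω.1) ∂(sg E) = 0) : ∫ x, p x * g x = 0 := by
  by_cases hi : Integrable (fun x => p x * g x)
  · rw [polar_integral, integral_prod_symm _ ((polar_integrable _).1 hi)]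
    obtain ⟨e, he⟩ := (NormedSpace.sphere_nonempty (E := E) (x := 0) (r := 1)).2 zero_le_one
    have : ∀ r : Set.Ioi (0:ℝ), ∫ ω : Metric.sphere (0:E) 1,
        p (r.1 • ω.1) * g (r.1 • ω.1) ∂(sg E) = 0 := by
      intro r
      have h : ∀ ω : Metric.sphere (0:E) 1, p (r.1 • ω.1) = p (r.1 • e) := fun ω => by
        apply hp
        rw [norm_smul, norm_smul, mem_sphere_zero_iff_norm.1 he, mem_sphere_zero_iff_norm.1 ω.2]
      simp only [h]
      rw [integral_const_mul, hg r.1 r.2, mul_zero]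
    simp only [this, integral_zero]
  · exact integral_undef hi

lemma int_bdd {f : E → ℝ} {M B : ℝ} (hf : Measurable f) (hM : ∀ x, |f x| ≤ M)
    (hB : ∀ x, B < ‖x‖ → f x = 0) : Integrable f := by
  have : f = (Metric.closedBall (0:E) B).indicator f := by
    ext x
    by_cases hx : ‖x‖ ≤ B
    · rw [Set.indicator_of_mem (by simpa using hx)]
    · rw [Set.indicator_of_notMem (by simpa using hx), hB _ (lt_of_not_ge hx)]
  rw [this, integrable_indicator_iff Metric.isClosed_closedBall.measurableSet]
  exact Measure.integrableOn_of_bounded (M := M) ((isCompact_closedBall _ _).measure_lt_top.ne)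
    hf.aestronglyMeasurable (Eventually.of_forall hM)

lemma mn_zero [Nontrivial E] {w : E → ℝ} (hw : Continuous w) (hws : HasCompactSupport w)
    (hproj : ∀ q : E → ℝ, ContDiff ℝ (⊤ : ℕ∞) q → HasCompactSupport q →
      (∀ x y : E, ‖x‖ = ‖y‖ → q x = q y) → (∫ x, w x * q x) = 0) :
    ∀ r, 0 < r → mn w r = 0 := by
  set d := Module.finrank ℝ E - 1 with hd
  have hc : Continuous fun r : ℝ => r ^ d * mn w r := (continuous_pow d).mul (mn_cont hw)
  have hae : ∀ᵐ r : ℝ, r ∈ Set.Ioi (0:ℝ) → r ^ d * mn w r = 0 := by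
    refine isOpen_Ioi.ae_eq_zero_of_integral_contDiff_smul_eq_zero
      (hc.locallyIntegrable.locallyIntegrableOn _) ?_
    intro η hη hηs hηt
    have hneg : ∀ r, r ≤ 0 → η r = 0 := fun r hr =>
      image_eq_zero_of_notMem_tsupport fun h => absurd (hηt h) (not_lt.2 hr)
    obtain ⟨a, ha, ha0⟩ : ∃ a, 0 < a ∧ ∀ r, r ≤ a → η r = 0 := by
      have h0 : (0:ℝ) ∈ (tsupport η)ᶜ := fun h => absurd (Set.mem_Ioi.1 (hηt h)) (lt_irrefl _)
      obtain ⟨ε, hε, hb⟩ := Metric.isOpen_iff.1 (isClosed_tsupport η).isOpen_compl 0 h0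
      refine ⟨ε / 2, by positivity, fun r hr => ?_⟩
      by_cases h : r ≤ 0
      · exact hneg r h
      · refine image_eq_zero_of_notMem_tsupport (hb ?_)
        rw [mem_ball_zero_iff, Real.norm_eq_abs, abs_of_pos (not_le.1 h)]; linarith
    obtain ⟨b, hb⟩ : ∃ b, ∀ r, b ≤ r → η r = 0 := by
      obtain ⟨c, hc⟩ := hηs.isCompact.isBounded.subset_ball (0:ℝ)
      refine ⟨c, fun r hr => image_eq_zero_of_notMem_tsupport fun h => ?_⟩
      have := mem_ball_zero_iff.1 (hc h)
      rw [Real.norm_eq_abs] at this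
      linarith [le_abs_self r]
    have hq := hproj (fun x => η ‖x‖) (rad_smooth ha hη ha0) (rad_supp hb)
      (fun x y h => by simp only [h])
    have hi : Integrable fun x : E => w x * η ‖x‖ :=
      (hw.mul (hη.continuous.comp continuous_norm)).integrable_of_hasCompactSupport hws.mul_right
    rw [polar_integral, integral_prod_symm _ ((polar_integrable _).1 hi)] at hq
    have h1 : ∀ r : Set.Ioi (0:ℝ), ∫ ω : Metric.sphere (0:E) 1,
        w (r.1 • ω.1) * η ‖r.1 • ω.1‖ ∂(sg E) = mn w r * η r := by
      intro r
      rw [mn, ← integral_mul_const]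
      refine integral_congr_ae (Eventually.of_forall fun ω => ?_)
      have := pol_norm (E := E) (ω, r)
      simp only at this ⊢
      rw [this]
    simp only [h1] at hq
    rw [integral_rm (E := E) (fun r => mn w r * η r)] at hq
    rw [← hq, ← integral_indicator measurableSet_Ioi]
    congr 1; ext r
    by_cases hr : 0 < r
    · rw [Set.indicator_of_mem (by exact hr)]; simp only [smul_eq_mul]; ring
    · rw [Set.indicator_of_notMem (by exact hr), hneg r (not_lt.1 hr), zero_smul]
  have heq : Set.EqOn (fun r : ℝ => r ^ d * mn w r) (fun _ => 0) (Set.Ioi 0) :=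
    Measure.eqOn_open_of_ae_eq (μ := volume) ((ae_restrict_iff' measurableSet_Ioi).2 hae) isOpen_Ioi
      hc.continuousOn continuousOn_const
  intro r hr
  exact (mul_eq_zero.1 (heq hr)).resolve_left (pow_ne_zero _ hr.ne')

lemma w_zero [Nontrivial E] {w : E → ℝ} (hw : Continuous w) (h : ∀ r, 0 < r → mn w r = 0) :
    w 0 = 0 := by
  have h1 : Tendsto (mn w) (𝓝[>] 0) (𝓝 (mn w 0)) := (mn_cont hw).continuousAt.mono_left nhdsWithin_le_nhds
  have h2 : Tendsto (mn w) (𝓝[>] 0) (𝓝 0) := by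
    refine tendsto_const_nhds.congr' ?_
    filter_upwards [self_mem_nhdsWithin] with r hr using (h r hr).symm
  have h3 := tendsto_nhds_unique h1 h2
  simp only [mn, zero_smul, integral_const, smul_eq_mul] at h3
  exact (mul_eq_zero.1 h3).resolve_left sg_pos.ne'

lemma ray_deriv {w : E → ℝ} (hw : ContDiff ℝ 1 w) (ω : E) (r : ℝ) :
    HasDerivAt (fun r : ℝ => w (r • ω)) (inner ℝ (gradient w (r • ω)) ω) r := by
  have h : HasDerivAt (fun r : ℝ => r • ω) ω r := by
    simpa using (hasDerivAt_id r).smul_const ω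
  rw [inner_grad]
  exact ((hw.differentiable (by simp) (r • ω)).hasFDerivAt).comp_hasDerivAt r h

lemma grad_bdd {w : E → ℝ} (hw : ContDiff ℝ 1 w) (hws : HasCompactSupport w) :
    ∃ L, 0 ≤ L ∧ ∀ x, ‖gradient w x‖ ≤ L := by
  obtain ⟨L, hL⟩ := (hws.fderiv ℝ).exists_bound_of_continuous (hw.continuous_fderiv (by simp))
  exact ⟨L, (norm_nonneg _).trans (hL 0), fun x => by rw [norm_grad]; exact hL x⟩

lemma mn_deriv_zero [Nontrivial E] {w : E → ℝ} (hw : ContDiff ℝ 1 w) (hws : HasCompactSupport w)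
    (h : ∀ r, 0 < r → mn w r = 0) {r : ℝ} (hr : 0 < r) :
    ∫ ω : Metric.sphere (0:E) 1, inner ℝ (gradient w (r • ω.1)) ω.1 ∂(sg E) = 0 := by
  obtain ⟨L, hL0, hL⟩ := grad_bdd hw hws
  have hcont : ∀ r : ℝ, Continuous fun x : E => w (r • x) := fun r => hw.continuous.comp (continuous_const_smul r)
  have hcont' : Continuous fun x : E => inner ℝ (gradient w (r • x)) x :=
    ((grad_cont hw).comp (continuous_const_smul r)).inner continuous_id
  have hd := (hasDerivAt_integral_of_dominated_loc_of_deriv_le (μ := sg E) (s := Set.univ) (x₀ := r)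
    (F := fun r ω => w (r • ω.1)) (F' := fun r ω => inner ℝ (gradient w (r • ω.1)) ω.1)
    (bound := fun _ => L) Filter.univ_mem
    (Eventually.of_forall fun r => (sph_int (hcont r)).aestronglyMeasurable)
    (sph_int (hcont r)) (sph_int hcont').aestronglyMeasurable
    (Eventually.of_forall fun ω r _ => by
      refine (norm_inner_le_norm _ _).trans ?_
      rw [mem_sphere_zero_iff_norm.1 ω.2, mul_one]; exact hL _) (integrable_const _)
    (Eventually.of_forall fun ω r _ => ray_deriv hw _ _)).2
  have h0 : (fun r : ℝ => ∫ ω : Metric.sphere (0:E) 1, w (r • ω.1) ∂(sg E)) =ᶠ[𝓝 r] fun _ => 0 := by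
    filter_upwards [Ioi_mem_nhds hr] with s hs using h s hs
  rw [← hd.deriv, h0.deriv_eq]; simp

end mean
end ISD

namespace ISD

section fin
variable {E : Type*} [NormedAddCommGroup E] [InnerProductSpace ℝ E] [FiniteDimensional ℝ E]
  [MeasurableSpace E] [BorelSpace E]

open Filter Topology

/-- radial derivative -/
noncomputable def dr (w : E → ℝ) (x : E) : ℝ := inner ℝ (gradient w x) (‖x‖⁻¹ • x)

lemma dr_meas (w : E → ℝ) : Measurable (dr w) :=
  (meas_grad w).inner ((measurable_norm.inv).smul measurable_id)

lemma supp_bd {w : E → ℝ} (hws : HasCompactSupport w) :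
    ∃ B, 0 < B ∧ (∀ x, B ≤ ‖x‖ → w x = 0) ∧ (∀ x, B ≤ ‖x‖ → gradient w x = 0) := by
  obtain ⟨c, hc⟩ := hws.isCompact.isBounded.subset_ball (0:E)
  have h1 : ∀ x, max c 1 ≤ ‖x‖ → x ∉ tsupport w := fun x hx h => by
    have := mem_ball_zero_iff.1 (hc h)
    linarith [le_max_left c 1]
  refine ⟨max c 1, by positivity, fun x hx => image_eq_zero_of_notMem_tsupport (h1 x hx), fun x hx => ?_⟩
  rw [← norm_eq_zero, norm_grad, norm_eq_zero]
  exact image_eq_zero_of_notMem_tsupport fun h => h1 x hx (tsupport_fderiv_subset ℝ h)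

lemma dr_le (w : E → ℝ) (x : E) : |dr w x| ≤ ‖gradient w x‖ := by
  refine (abs_real_inner_le_norm _ _).trans ?_
  rw [norm_smul, norm_inv, norm_norm]
  exact mul_le_of_le_one_right (norm_nonneg _) (inv_mul_le_one)

lemma dr_int {w : E → ℝ} (hw : ContDiff ℝ 1 w) (hws : HasCompactSupport w) :
    Integrable fun x => dr w x ^ 2 := by
  obtain ⟨L, hL0, hL⟩ := grad_bdd hw hws
  obtain ⟨B, _, _, hB⟩ := supp_bd hws
  refine int_bdd (M := L ^ 2) (B := B) ((dr_meas w).pow_const 2) (fun x => ?_) (fun x hx => ?_)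
  · rw [abs_pow]
    have := (dr_le w x).trans (hL x)
    gcongr
  · simp [dr, hB x hx.le]

lemma grad_int {w : E → ℝ} (hw : ContDiff ℝ 1 w) (hws : HasCompactSupport w) :
    Integrable fun x => ‖gradient w x‖ ^ 2 := by
  obtain ⟨L, hL0, hL⟩ := grad_bdd hw hws
  obtain ⟨B, _, _, hB⟩ := supp_bd hws
  refine int_bdd (M := L ^ 2) (B := B) ((meas_grad w).norm.pow_const 2) (fun x => ?_) (fun x hx => ?_)
  · rw [abs_pow, abs_norm]
    have := hL x
    gcongr
  · simp [hB x hx.le]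

lemma lip0 {w : E → ℝ} (hw : ContDiff ℝ 1 w) {L : ℝ} (hL : ∀ x, ‖gradient w x‖ ≤ L) (h0 : w 0 = 0)
    (x : E) : |w x| ≤ L * ‖x‖ := by
  have := convex_univ.norm_image_sub_le_of_norm_fderiv_le (𝕜 := ℝ) (f := w) (C := L) (x := 0) (y := x)
    (fun x _ => hw.differentiable (by simp) x) (fun x _ => by rw [← norm_grad]; exact hL x)
    (Set.mem_univ _) (Set.mem_univ _)
  simpa [h0] using this

lemma hardy_int {w : E → ℝ} (hw : ContDiff ℝ 1 w) (hws : HasCompactSupport w) (h0 : w 0 = 0) :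
    Integrable fun x => w x ^ 2 / ‖x‖ ^ 2 := by
  obtain ⟨L, hL0, hL⟩ := grad_bdd hw hws
  obtain ⟨B, _, hB, _⟩ := supp_bd hws
  refine int_bdd (M := L ^ 2) (B := B) ?_ (fun x => ?_) (fun x hx => ?_)
  · exact (hw.continuous.measurable.pow_const 2).div (measurable_norm.pow_const 2)
  · rw [← div_pow, abs_pow, abs_div, abs_norm]
    gcongr
    exact div_le_of_le_mul₀ (norm_nonneg _) hL0 (lip0 hw hL h0 x)
  · simp [hB x hx.le]

lemma V_int {V : E → ℝ} (hV : LocallyIntegrable V) {f : E → ℝ} (hf : Continuous f)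
    (hfs : HasCompactSupport f) : Integrable fun x => V x * f x :=
  by simpa using hV.integrable_smul_right_of_hasCompactSupport hf hfs

lemma dr_polar (w : E → ℝ) (p : Metric.sphere (0:E) 1 × Set.Ioi (0:ℝ)) :
    dr w (p.2.1 • p.1.1) = inner ℝ (gradient w (p.2.1 • p.1.1)) p.1.1 := by
  rw [dr, pol_dir]

/-- step A -/
lemma stepA [Nontrivial E] {V : E → ℝ} (hVrad : ∀ x y : E, ‖x‖ = ‖y‖ → V x = V y)
    (hV : LocallyIntegrable V) (hR : RH V) {w : E → ℝ} (hw : ContDiff ℝ 1 w)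
    (hws : HasCompactSupport w) (h0 : w 0 = 0) :
    ∫ x, V x * w x ^ 2 ≤ ∫ x, dr w x ^ 2 := by
  obtain ⟨e, he⟩ := (NormedSpace.sphere_nonempty (E := E) (x := 0) (r := 1)).2 zero_le_one
  have he1 := mem_sphere_zero_iff_norm.1 he
  obtain ⟨B, hB0, hB, _⟩ := supp_bd hws
  have hiV : Integrable fun x => V x * w x ^ 2 := by
    refine V_int hV (hw.continuous.pow 2) ?_
    have : (fun x => w x ^ 2) = fun x => w x * w x := by ext; ring
    exact this ▸ hws.mul_right
  have hid := dr_int hw hws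
  rw [polar_integral, polar_integral (fun x => dr w x ^ 2),
    integral_prod _ ((polar_integrable _).1 hiV), integral_prod _ ((polar_integrable _).1 hid)]
  refine integral_mono ((polar_integrable _).1 hiV).integral_prod_left
    ((polar_integrable _).1 hid).integral_prod_left fun ω => ?_
  have hω : ‖ω.1‖ = 1 := mem_sphere_zero_iff_norm.1 ω.2
  have hray := hardy2 (E := E) hV hR (φ := fun r => w (r • ω.1)) (b := B)
    (hw.comp (contDiff_id.smul contDiff_const)) (by simpa using h0)
    (fun r hr => hB _ (by rw [norm_smul, hω, mul_one]; exact hr.trans (le_abs_self r)))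
  have hVe : ∀ x : E, V x = V (‖x‖ • e) := fun x => hVrad _ _ (by rw [norm_smul, he1]; simp)
  simp only [fun r => (ray_deriv hw ω.1 r).deriv] at hray
  have e1 : ∫ x : E, V x * w (‖x‖ • ω.1) ^ 2 = ∫ x : E, (fun r : ℝ => V (r • e) * w (r • ω.1) ^ 2) ‖x‖ := by
    congr 1; ext x; simp only; rw [hVe x]
  rw [e1, rad_int (fun r : ℝ => V (r • e) * w (r • ω.1) ^ 2), rad_int (fun r : ℝ => (inner ℝ (gradient w (r • ω.1)) ω.1 : ℝ) ^ 2)] at hray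
  have hray := le_of_mul_le_mul_left hray sg_pos
  refine Eq.trans_le ?_ (hray.trans_eq ?_)
  · refine integral_congr_ae (Eventually.of_forall fun r => ?_)
    simp only
    rw [hVrad (r.1 • ω.1) (r.1 • e) (by rw [norm_smul, norm_smul, he1, hω])]
  · refine integral_congr_ae (Eventually.of_forall fun r => ?_)
    simp only
    rw [dr_polar w (ω, r)]

/-- step B -/
lemma stepB [Nontrivial E] {w : E → ℝ} (hw : ContDiff ℝ 1 w)
    (hws : HasCompactSupport w) (hm : ∀ r, 0 < r → mn w r = 0) :
    ((Module.finrank ℝ E : ℝ) - 1) * ∫ x, w x ^ 2 / ‖x‖ ^ 2 ≤ (∫ x, ‖gradient w x‖ ^ 2) - ∫ x, dr w x ^ 2 := by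
  have h0 := w_zero hw.continuous hm
  have hi1 := hardy_int hw hws h0
  have hi2 : Integrable fun x => ‖gradient w x‖ ^ 2 - dr w x ^ 2 := (grad_int hw hws).sub (dr_int hw hws)
  rw [← integral_sub (grad_int hw hws) (dr_int hw hws), polar_integral,
    polar_integral (fun x => ‖gradient w x‖ ^ 2 - dr w x ^ 2),
    integral_prod_symm _ ((polar_integrable _).1 hi1), integral_prod_symm _ ((polar_integrable _).1 hi2),
    ← integral_const_mul]
  refine integral_mono (((polar_integrable _).1 hi1).integral_prod_right.const_mul _)
    ((polar_integrable _).1 hi2).integral_prod_right fun r => ?_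
  have hr : (0:ℝ) < r.1 := r.2
  have hfd : ∀ x, gradient (fun x => w (r.1 • x)) x = r.1 • gradient w (r.1 • x) := fun x => by
    refine ext_inner_right ℝ fun v => ?_
    have h : HasFDerivAt (fun x : E => r.1 • x) (r.1 • ContinuousLinearMap.id ℝ E) x :=
      (hasFDerivAt_id x).const_smul r.1
    have h2 := ((hw.differentiable (by simp) (r.1 • x)).hasFDerivAt).comp x h
    rw [inner_grad, inner_smul_left, inner_grad]
    have h3 : fderiv ℝ (fun x => w (r.1 • x)) x = _ := h2.fderiv
    rw [h3]; simp
  have hsp := sphere_poincare (E := E) (f := fun x => w (r.1 • x))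
    (hw.comp (contDiff_const.smul contDiff_id)) (hm r.1 hr)
  have e1 : ∫ ω : Metric.sphere (0:E) 1, w (r.1 • ω.1) ^ 2 / ‖r.1 • ω.1‖ ^ 2 ∂(sg E)
      = (r.1 ^ 2)⁻¹ * ∫ ω : Metric.sphere (0:E) 1, w (r.1 • ω.1) ^ 2 ∂(sg E) := by
    rw [← integral_const_mul]
    refine integral_congr_ae (Eventually.of_forall fun ω => ?_)
    simp only
    rw [pol_norm (ω, r)]
    field_simp
  have e2 : ∫ ω : Metric.sphere (0:E) 1, (‖gradient w (r.1 • ω.1)‖ ^ 2 - dr w (r.1 • ω.1) ^ 2) ∂(sg E)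
      = (r.1 ^ 2)⁻¹ * ∫ ω : Metric.sphere (0:E) 1, tg (fun x => w (r.1 • x)) ω.1 ∂(sg E) := by
    rw [← integral_const_mul]
    refine integral_congr_ae (Eventually.of_forall fun ω => ?_)
    simp only [tg]
    rw [dr_polar w (ω, r), hfd, norm_smul, inner_smul_left, Real.norm_eq_abs, abs_of_pos hr]
    simp only [conj_trivial]
    field_simp
  simp only
  rw [e1, e2]
  have := mul_le_mul_of_nonneg_left hsp (by positivity : (0:ℝ) ≤ (r.1 ^ 2)⁻¹)
  linarith

/-- step C -/
lemma stepC [Nontrivial E] {V : E → ℝ} (hV : LocallyIntegrable V) {θ : ℝ}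
    (hθ1 : ∀ᵐ x : E, ‖x‖ ^ 2 * V x ≤ θ) {w : E → ℝ} (hw : ContDiff ℝ 1 w)
    (hws : HasCompactSupport w) (h0 : w 0 = 0) :
    ∫ x, V x * w x ^ 2 ≤ θ * ∫ x, w x ^ 2 / ‖x‖ ^ 2 := by
  have hiV : Integrable fun x => V x * w x ^ 2 := by
    refine V_int hV (hw.continuous.pow 2) ?_
    have : (fun x => w x ^ 2) = fun x => w x * w x := by ext; ring
    exact this ▸ hws.mul_right
  have hne : ∀ᵐ x : E, x ≠ 0 := by
    simp [ae_iff]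
  rw [← integral_const_mul]
  refine integral_mono_ae hiV ((hardy_int hw hws h0).const_mul _) ?_
  filter_upwards [hθ1, hne] with x hx hx0
  have hn := norm_pos_iff.2 hx0
  have : V x * w x ^ 2 = (‖x‖ ^ 2 * V x) * (w x ^ 2 / ‖x‖ ^ 2) := by field_simp
  rw [this]
  gcongr

lemma core [Nontrivial E] {V : E → ℝ} (hVrad : ∀ x y : E, ‖x‖ = ‖y‖ → V x = V y)
    (hV : LocallyIntegrable V) (hR : RH V) {θ : ℝ} (hθ : 0 < θ)
    (hθ1 : ∀ᵐ x : E, ‖x‖ ^ 2 * V x ≤ θ) {n : ℝ} (hn : (Module.finrank ℝ E : ℝ) = n) (hn2 : 2 ≤ n)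
    {w : E → ℝ} (hw : ContDiff ℝ 1 w)
    (hws : HasCompactSupport w) (hm : ∀ r, 0 < r → mn w r = 0) :
    (∫ x, V x * w x ^ 2) + ((n - 1) / (n - 1 + θ)) * ∫ x, ‖gradient w x‖ ^ 2
      ≤ ∫ x, ‖gradient w x‖ ^ 2 := by
  have h0 := w_zero hw.continuous hm
  have hA := stepA hVrad hV hR hw hws h0
  have hB := stepB hw hws hm
  have hC := stepC hV hθ1 hw hws h0
  rw [hn] at hB
  set a := ∫ x, V x * w x ^ 2
  set g := ∫ x, ‖gradient w x‖ ^ 2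
  set d := ∫ x, dr w x ^ 2
  set q := ∫ x, w x ^ 2 / ‖x‖ ^ 2
  have hp : 0 < n - 1 + θ := by linarith
  have e : (n - 1) / (n - 1 + θ) * g = ((n-1) * g) / (n - 1 + θ) := by ring
  rw [e, ← le_sub_iff_add_le', div_le_iff₀ hp]
  nlinarith [mul_le_mul_of_nonneg_left hA hθ.le, mul_le_mul_of_nonneg_left hB hθ.le,
    mul_le_mul_of_nonneg_left hC (by linarith : 0 ≤ n - 1)]

lemma rad_form [Nontrivial E] {u : E → ℝ} (hu : ContDiff ℝ 1 u)
    (hr : ∀ x y : E, ‖x‖ = ‖y‖ → u x = u y) : ∃ p : E → ℝ, (∀ x y : E, ‖x‖ = ‖y‖ → p x = p y) ∧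
      ∀ x, x ≠ 0 → gradient u x = p x • (‖x‖⁻¹ • x) := by
  obtain ⟨e, he⟩ := (NormedSpace.sphere_nonempty (E := E) (x := 0) (r := 1)).2 zero_le_one
  have he1 := mem_sphere_zero_iff_norm.1 he
  have hφ : u = fun x => (fun r : ℝ => u (r • e)) ‖x‖ := by
    ext x; exact hr _ _ (by rw [norm_smul, he1]; simp)
  refine ⟨fun x => deriv (fun r : ℝ => u (r • e)) ‖x‖, fun x y h => by simp only [h], fun x hx => ?_⟩
  have := rad_grad (φ := fun r : ℝ => u (r • e)) hx (ray_deriv hu e _).differentiableAt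
  rw [← this, ← hφ]

lemma cross_grad [Nontrivial E] {u w : E → ℝ} (hu : ContDiff ℝ 1 u)
    (hr : ∀ x y : E, ‖x‖ = ‖y‖ → u x = u y) (hw : ContDiff ℝ 1 w)
    (hws : HasCompactSupport w) (hm : ∀ r, 0 < r → mn w r = 0) :
    ∫ x, (inner ℝ (gradient u x) (gradient w x) : ℝ) = 0 := by
  obtain ⟨p, hp, hpg⟩ := rad_form hu hr
  have hne : ∀ᵐ x : E, x ≠ 0 := by
    simp [ae_iff]
  rw [← orth (p := p) (g := dr w) hp]
  · refine integral_congr_ae ?_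
    filter_upwards [hne] with x hx
    rw [hpg x hx, inner_smul_left, dr, real_inner_comm]; simp
  · intro r hr'
    rw [← mn_deriv_zero hw hws hm hr']
    refine integral_congr_ae (Eventually.of_forall fun ω => ?_)
    exact dr_polar w (ω, ⟨r, hr'⟩)

lemma grad_sub {u v : E → ℝ} (hu : ContDiff ℝ 1 u) (hv : ContDiff ℝ 1 v) (x : E) :
    gradient (fun x => u x - v x) x = gradient u x - gradient v x := by
  refine ext_inner_right ℝ fun y => ?_
  have h := ((hu.differentiable (by simp) x).hasFDerivAt.sub (hv.differentiable (by simp) x).hasFDerivAt).fderiv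
  have h : fderiv ℝ (fun x => u x - v x) x = _ := h
  rw [inner_grad, inner_sub_left, inner_grad, inner_grad, h]; simp

theorem main [Nontrivial E] {V : E → ℝ} (hVrad : ∀ x y : E, ‖x‖ = ‖y‖ → V x = V y)
    (hV : LocallyIntegrable V) (hR : RH V) {θ : ℝ} (hθ : 0 < θ)
    (hθ1 : ∀ᵐ x : E, ‖x‖ ^ 2 * V x ≤ θ) {n : ℝ} (hn : (Module.finrank ℝ E : ℝ) = n) (hn2 : 2 ≤ n)
    {u u₀ : E → ℝ} (hu : ContDiff ℝ 1 u) (hus : HasCompactSupport u)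
    (hu₀ : ContDiff ℝ 1 u₀) (hu₀s : HasCompactSupport u₀)
    (hu₀rad : ∀ x y : E, ‖x‖ = ‖y‖ → u₀ x = u₀ y)
    (hproj : ∀ w : E → ℝ,
      ContDiff ℝ (⊤ : ℕ∞) w → HasCompactSupport w →
      (∀ x y : E, ‖x‖ = ‖y‖ → w x = w y) →
      (∫ x, (u x - u₀ x) * w x) = 0) :
    (∫ x, ‖gradient u₀ x‖ ^ 2) - (∫ x, V x * u₀ x ^ 2)
      + ((n - 1) / (n - 1 + θ)) * ∫ x, ‖gradient u x - gradient u₀ x‖ ^ 2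
    ≤ (∫ x, ‖gradient u x‖ ^ 2) - ∫ x, V x * u x ^ 2 := by
  obtain ⟨w, hwdef⟩ : ∃ w : E → ℝ, w = fun x => u x - u₀ x := ⟨_, rfl⟩
  have hw : ContDiff ℝ 1 w := hwdef ▸ hu.sub hu₀
  have hws : HasCompactSupport w := hwdef ▸ hus.sub hu₀s
  have hm : ∀ r, 0 < r → mn w r = 0 := mn_zero hw.continuous hws (by subst hwdef; exact hproj)
  have hg : ∀ x, gradient w x = gradient u x - gradient u₀ x := fun x => by
    subst hwdef; exact grad_sub hu hu₀ x
  have hcore := core hVrad hV hR hθ hθ1 hn hn2 hw hws hm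
  have hsq : ∀ f : E → ℝ, HasCompactSupport f → HasCompactSupport fun x => f x ^ 2 := fun f hf => by
    have : (fun x => f x ^ 2) = fun x => f x * f x := by ext; ring
    exact this ▸ hf.mul_right
  have hV0 : Integrable fun x => V x * u₀ x ^ 2 := V_int hV (hu₀.continuous.pow 2) (hsq _ hu₀s)
  have hVw : Integrable fun x => V x * w x ^ 2 := V_int hV (hw.continuous.pow 2) (hsq _ hws)
  have hVc : Integrable fun x => V x * u₀ x * w x := by
    have : Integrable fun x => V x * (u₀ x * w x) := V_int hV (hu₀.continuous.mul hw.continuous) hu₀s.mul_right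
    exact this.congr (Eventually.of_forall fun x => by ring)
  have hc1 : ∫ x, V x * u₀ x * w x = 0 := by
    refine orth (p := fun x => V x * u₀ x) (g := w) (fun x y h => ?_) (fun r hr => hm r hr)
    rw [hVrad x y h, hu₀rad x y h]
  have hc2 := cross_grad hu₀ hu₀rad hw hws hm
  have hgi : Integrable fun x => (inner ℝ (gradient u₀ x) (gradient w x) : ℝ) := by
    refine ((grad_cont hu₀).inner (grad_cont hw)).integrable_of_hasCompactSupport ?_
    obtain ⟨B, _, _, hB⟩ := supp_bd hws
    refine HasCompactSupport.intro (isCompact_closedBall (0:E) B) fun x hx => ?_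
    rw [hB x (by simpa using (by simpa using hx : B < ‖x‖).le), inner_zero_right]
  have hE1 : ∫ x, ‖gradient u x‖ ^ 2 = (∫ x, ‖gradient u₀ x‖ ^ 2) + ∫ x, ‖gradient w x‖ ^ 2 := by
    have h1 : ∀ x, ‖gradient u x‖ ^ 2 = (‖gradient u₀ x‖ ^ 2 + ‖gradient w x‖ ^ 2)
        + 2 * (inner ℝ (gradient u₀ x) (gradient w x) : ℝ) := fun x => by
      have : gradient u x = gradient u₀ x + gradient w x := by rw [hg]; abel
      rw [this, norm_add_sq_real]; ring
    simp only [h1]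
    have hadd : Integrable fun x => ‖gradient u₀ x‖ ^ 2 + ‖gradient w x‖ ^ 2 :=
      (grad_int hu₀ hu₀s).add (grad_int hw hws)
    rw [integral_add hadd (hgi.const_mul 2),
      integral_add (grad_int hu₀ hu₀s) (grad_int hw hws), integral_const_mul, hc2]
    ring
  have hE2 : ∫ x, V x * u x ^ 2 = (∫ x, V x * u₀ x ^ 2) + ∫ x, V x * w x ^ 2 := by
    have h1 : ∀ x, V x * u x ^ 2 = (V x * u₀ x ^ 2 + V x * w x ^ 2) + 2 * (V x * u₀ x * w x) := fun x => by
      rw [hwdef]; ring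
    simp only [h1]
    have hadd : Integrable fun x => V x * u₀ x ^ 2 + V x * w x ^ 2 := hV0.add hVw
    rw [integral_add hadd (hVc.const_mul 2), integral_add hV0 hVw, integral_const_mul, hc1]
    ring
  simp only [← hg]
  rw [hE1, hE2]
  linarith

end fin
end ISD

/-- improved decomposition inequality involving the spherical
average u₀ (characterized as the L²-orthogonal projection onto radial
functions) with constant (N-1)/(N-1+θ). -/
theorem improved_spherical_decomposition (N : ℕ) (hN : 2 ≤ N) (θ : ℝ) (hθ : 0 < θ)
    (V : EuclideanSpace ℝ (Fin N) → ℝ)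
    (hVrad : ∀ x y : EuclideanSpace ℝ (Fin N), ‖x‖ = ‖y‖ → V x = V y)
    (hVloc : LocallyIntegrable V)
    (hVbd : ∀ x : EuclideanSpace ℝ (Fin N), x ≠ 0 →
      ∃ U ∈ nhds x, BddAbove ((fun y => |V y|) '' U))
    -- θ = ess sup |x|² V(x)
    (hθ1 : ∀ᵐ x : EuclideanSpace ℝ (Fin N), ‖x‖ ^ 2 * V x ≤ θ)
    -- the Hardy-type inequality for radial test functions
    (hrad : ∀ u : EuclideanSpace ℝ (Fin N) → ℝ,
      ContDiff ℝ (⊤ : ℕ∞) u → HasCompactSupport u →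
      (∀ x y : EuclideanSpace ℝ (Fin N), ‖x‖ = ‖y‖ → u x = u y) →
      (∫ x, V x * u x ^ 2) ≤ ∫ x, ‖gradient u x‖ ^ 2)
    (u u₀ : EuclideanSpace ℝ (Fin N) → ℝ)
    (hu : ContDiff ℝ (⊤ : ℕ∞) u) (hus : HasCompactSupport u)
    -- u₀ is the spherical average of u: it is radial and, on each sphere,
    -- u - u₀ integrates to zero against every radial test function
    (hu₀C : ContDiff ℝ 1 u₀) (hu₀s : HasCompactSupport u₀)
    (hu₀rad : ∀ x y : EuclideanSpace ℝ (Fin N), ‖x‖ = ‖y‖ → u₀ x = u₀ y)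
    (hu₀proj : ∀ w : EuclideanSpace ℝ (Fin N) → ℝ,
      ContDiff ℝ (⊤ : ℕ∞) w → HasCompactSupport w →
      (∀ x y : EuclideanSpace ℝ (Fin N), ‖x‖ = ‖y‖ → w x = w y) →
      (∫ x, (u x - u₀ x) * w x) = 0) :
    (∫ x, ‖gradient u₀ x‖ ^ 2) - (∫ x, V x * u₀ x ^ 2)
      + (((N : ℝ) - 1) / ((N : ℝ) - 1 + θ)) * ∫ x, ‖gradient u x - gradient u₀ x‖ ^ 2
    ≤ (∫ x, ‖gradient u x‖ ^ 2) - ∫ x, V x * u x ^ 2 := by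
  have hnt : Nontrivial (EuclideanSpace ℝ (Fin N)) := by
    apply Module.nontrivial_of_finrank_pos (R := ℝ)
    rw [finrank_euclideanSpace_fin]; omega
  exact ISD.main hVrad hVloc hrad hθ hθ1 (by rw [finrank_euclideanSpace_fin]) (by exact_mod_cast hN)
    (hu.of_le (by exact_mod_cast le_top)) hus hu₀C hu₀s hu₀rad hu₀proj
end

section
/- For N ≥ 3, k ≥ 1, 0 < μ ≤ 1/4, let β be the largest root of β(1−β) = μ and set φ_{k,β}(x) = |x|^{−(N−2)/2} X₁^{−1/2}(|x|/D) ⋯ X_{k−1}^{−1/2}(|x|/D) X_k^{−β}(|x|/D), where D = sup_Ω |x|. Then φ_{k,β} satisfies Δφ_{k,β} + V_k^μ φ_{k,β} = 0 on Ω∖{0}, where V_k^μ(x) = ((N−2)/2)²/|x|² + (1/(4|x|²)) Σ_{i=1}^{k−1} X₁² ⋯ X_i² + (μ/|x|²) X₁² ⋯ X_k², and consequently ∫_Ω(|∇u|² − V_k^μ u²) dx = ∫_Ω |∇w|² φ_{k,β}² dx for u = φ_{k,β} w, w ∈ C_c^∞(Ω∖{0}). -/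
open MeasureTheory Real

/-- Iterated logarithm X₁(t) = (1 - log t)⁻¹, X_{k+1} = X₁ ∘ X_k. -/
noncomputable def iterX : ℕ → ℝ → ℝ
  | 0, t => t
  | (k + 1), t => (1 - Real.log (iterX k t))⁻¹

/-- The Euclidean Laplacian, as the sum of the pure second partial derivatives. -/
noncomputable def euclideanLaplacian {N : ℕ} (f : EuclideanSpace ℝ (Fin N) → ℝ)
    (x : EuclideanSpace ℝ (Fin N)) : ℝ :=
  ∑ i : Fin N,
    fderiv ℝ (fun y => fderiv ℝ f y (EuclideanSpace.single i (1 : ℝ))) x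
      (EuclideanSpace.single i (1 : ℝ))


/-- The partial product X₁ ⋯ X_n at r / D. -/
noncomputable def gsP (D : ℝ) (n : ℕ) (r : ℝ) : ℝ := ∏ j ∈ Finset.Icc 1 n, iterX j (r / D)

lemma gsP_zero (D r : ℝ) : gsP D 0 r = 1 := by simp [gsP]

lemma gsP_succ (D r : ℝ) (n : ℕ) : gsP D (n + 1) r = gsP D n r * iterX (n + 1) (r / D) := by
  simp [gsP, Finset.prod_Icc_succ_top]

lemma iterX_mem (n : ℕ) (t : ℝ) (h0 : 0 < t) (h1 : t < 1) :
    0 < iterX n t ∧ iterX n t < 1 := by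
  induction n with
  | zero => exact ⟨h0, h1⟩
  | succ n ih =>
    have := Real.log_neg ih.1 ih.2
    simp only [iterX]
    exact ⟨by apply inv_pos.2; linarith, inv_lt_one_of_one_lt₀ (by linarith)⟩

lemma iterX_contDiffAt (D : ℝ) (n : ℕ) (r : ℝ) (h0 : 0 < r / D) (h1 : r / D < 1) :
    ContDiffAt ℝ (⊤ : ℕ∞) (fun s => iterX n (s / D)) r := by
  induction n with
  | zero => simp only [iterX]; fun_prop
  | succ n ih =>
    have h := iterX_mem n _ h0 h1
    have := Real.log_neg h.1 h.2
    simp only [iterX]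
    exact ((contDiffAt_const).sub (ih.log h.1.ne')).inv (by linarith)

lemma iterX_hasDerivAt (D : ℝ) (n : ℕ) (r : ℝ) (hr : 0 < r) (h0 : 0 < r / D) (h1 : r / D < 1) :
    HasDerivAt (fun s => iterX n (s / D)) (iterX n (r / D) * gsP D n r / r) r := by
  induction n with
  | zero =>
    simp only [iterX, gsP_zero]
    refine HasDerivAt.congr_deriv ((hasDerivAt_id r).div_const D) ?_
    field_simp
  | succ n ih =>
    have h := iterX_mem n _ h0 h1
    have hl := Real.log_neg h.1 h.2
    have hne : 1 - Real.log (iterX n (r / D)) ≠ 0 := by linarith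
    have := ((ih.log h.1.ne').const_sub 1).fun_inv hne
    simp only [iterX]
    refine HasDerivAt.congr_deriv this ?_
    rw [gsP_succ]
    simp only [iterX]
    have := h.1.ne'
    field_simp

lemma gsP_hasDerivAt (D : ℝ) (n : ℕ) (r : ℝ) (hr : 0 < r) (h0 : 0 < r / D) (h1 : r / D < 1) :
    HasDerivAt (gsP D n) (gsP D n r * (∑ j ∈ Finset.Icc 1 n, gsP D j r) / r) r := by
  induction n with
  | zero =>
    have : gsP D 0 = fun _ => 1 := by funext s; exact gsP_zero D s
    rw [this]; simpa using hasDerivAt_const r (1 : ℝ)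
  | succ n ih =>
    have : gsP D (n + 1) = fun s => gsP D n s * iterX (n + 1) (s / D) := by
      funext s; exact gsP_succ D s n
    rw [this]
    refine HasDerivAt.congr_deriv (ih.mul (iterX_hasDerivAt D (n + 1) r hr h0 h1)) ?_
    rw [Finset.sum_Icc_succ_top (by omega), gsP_succ]
    ring

lemma rpow_logDeriv {f : ℝ → ℝ} {c r a : ℝ} (hf : HasDerivAt f (f r * c) r) (h : 0 < f r) :
    HasDerivAt (fun s => f s ^ a) (f r ^ a * (a * c)) r := by
  refine HasDerivAt.congr_deriv (hf.rpow_const (p := a) (Or.inl h.ne')) ?_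
  rw [Real.rpow_sub_one h.ne']
  field_simp

/-- The product of X_i^{-1/2}. -/
lemma prodHalf_hasDerivAt (D : ℝ) (n : ℕ) (r : ℝ) (hr : 0 < r) (h0 : 0 < r / D)
    (h1 : r / D < 1) :
    HasDerivAt (fun s => ∏ i ∈ Finset.Icc 1 n, iterX i (s / D) ^ (-(1 : ℝ) / 2))
      ((∏ i ∈ Finset.Icc 1 n, iterX i (r / D) ^ (-(1 : ℝ) / 2))
        * (-(1 / 2) * (∑ j ∈ Finset.Icc 1 n, gsP D j r) / r)) r := by
  induction n with
  | zero => simpa using hasDerivAt_const r (1 : ℝ)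
  | succ n ih =>
    simp only [Finset.prod_Icc_succ_top (Nat.le_add_left 1 n)]
    have hd : HasDerivAt (fun s => iterX (n + 1) (s / D))
        (iterX (n + 1) (r / D) * (gsP D (n + 1) r / r)) r := by
      refine HasDerivAt.congr_deriv (iterX_hasDerivAt D (n + 1) r hr h0 h1) ?_
      ring
    refine HasDerivAt.congr_deriv (ih.mul (rpow_logDeriv (a := -(1 : ℝ) / 2) hd (iterX_mem _ _ h0 h1).1)) ?_
    rw [Finset.sum_Icc_succ_top (by omega)]
    ring

/-- The radial profile of φ_{k,β}, with k = n + 1. -/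
noncomputable def gsG (m β D : ℝ) (n : ℕ) (r : ℝ) : ℝ :=
  r ^ (-m) * (∏ i ∈ Finset.Icc 1 n, iterX i (r / D) ^ (-(1 : ℝ) / 2))
    * iterX (n + 1) (r / D) ^ (-β)

/-- r times the logarithmic derivative of the radial profile. -/
noncomputable def gsH (m β D : ℝ) (n : ℕ) (r : ℝ) : ℝ :=
  -m - 1 / 2 * (∑ j ∈ Finset.Icc 1 n, gsP D j r) - β * gsP D (n + 1) r

lemma gsG_hasDerivAt (m β D : ℝ) (n : ℕ) (r : ℝ) (hr : 0 < r) (h0 : 0 < r / D)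
    (h1 : r / D < 1) :
    HasDerivAt (gsG m β D n) (gsG m β D n r * gsH m β D n r / r) r := by
  have hd : HasDerivAt (fun s => iterX (n + 1) (s / D))
      (iterX (n + 1) (r / D) * (gsP D (n + 1) r / r)) r := by
    refine HasDerivAt.congr_deriv (iterX_hasDerivAt D (n + 1) r hr h0 h1) ?_
    ring
  have hi : HasDerivAt (fun s : ℝ => s) (r * (1 / r)) r := by
    refine HasDerivAt.congr_deriv (hasDerivAt_id r) ?_
    field_simp
  have := ((rpow_logDeriv (a := -m) hi hr).mul (prodHalf_hasDerivAt D n r hr h0 h1)).mul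
    (rpow_logDeriv (a := -β) hd (iterX_mem _ _ h0 h1).1)
  refine HasDerivAt.congr_deriv (f := gsG m β D n) this ?_
  simp only [gsG, gsH, Pi.mul_apply]
  ring

lemma gsG_contDiffAt (m β D : ℝ) (n : ℕ) (r : ℝ) (hr : 0 < r) (h0 : 0 < r / D)
    (h1 : r / D < 1) : ContDiffAt ℝ (⊤ : ℕ∞) (gsG m β D n) r := by
  unfold gsG
  refine ContDiffAt.mul (ContDiffAt.mul ?_ ?_) ?_
  · exact contDiffAt_id.rpow_const_of_ne hr.ne'
  · exact contDiffAt_prod fun i _ =>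
      (iterX_contDiffAt D i r h0 h1).rpow_const_of_ne (iterX_mem _ _ h0 h1).1.ne'
  · exact (iterX_contDiffAt D _ r h0 h1).rpow_const_of_ne (iterX_mem _ _ h0 h1).1.ne'

lemma gsSum_hasDerivAt (D : ℝ) (n : ℕ) (r : ℝ) (hr : 0 < r) (h0 : 0 < r / D)
    (h1 : r / D < 1) :
    HasDerivAt (fun s => ∑ j ∈ Finset.Icc 1 n, gsP D j s)
      ((1 / 2) * ((∑ j ∈ Finset.Icc 1 n, gsP D j r) ^ 2
        + ∑ j ∈ Finset.Icc 1 n, gsP D j r ^ 2) / r) r := by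
  induction n with
  | zero => simpa using hasDerivAt_const r (0 : ℝ)
  | succ n ih =>
    simp only [Finset.sum_Icc_succ_top (Nat.le_add_left 1 n)]
    refine HasDerivAt.congr_deriv (ih.add (gsP_hasDerivAt D (n + 1) r hr h0 h1)) ?_
    rw [Finset.sum_Icc_succ_top (by omega)]
    ring

/-- The Riccati form of the equation. -/
lemma gsH_hasDerivAt (m β D : ℝ) (n : ℕ) (r : ℝ) (hr : 0 < r) (h0 : 0 < r / D)
    (h1 : r / D < 1) :
    HasDerivAt (gsH m β D n) ((-(gsH m β D n r) ^ 2 - 2 * m * gsH m β D n r - m ^ 2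
      - 1 / 4 * (∑ j ∈ Finset.Icc 1 n, gsP D j r ^ 2)
      - β * (1 - β) * gsP D (n + 1) r ^ 2) / r) r := by
  have := (((gsSum_hasDerivAt D n r hr h0 h1).const_mul (1 / 2)).const_sub (-m)).sub
    ((gsP_hasDerivAt D (n + 1) r hr h0 h1).const_mul β)
  refine HasDerivAt.congr_deriv (f := gsH m β D n) this ?_
  rw [Finset.sum_Icc_succ_top (by omega)]
  simp only [gsH]
  ring

section Euclid

variable {N : ℕ}

lemma norm_hasFDerivAt' (x : EuclideanSpace ℝ (Fin N)) (hx : x ≠ 0) :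
    HasFDerivAt (fun y : EuclideanSpace ℝ (Fin N) => ‖y‖) ((1 / ‖x‖) • innerSL ℝ x) x := by
  have hn : ‖x‖ ≠ 0 := norm_ne_zero_iff.2 hx
  have h := (hasStrictFDerivAt_norm_sq x).hasFDerivAt.sqrt (by positivity)
  simp only [Real.sqrt_sq (norm_nonneg _)] at h
  refine h.congr_fderiv ?_
  ext v
  simp
  field_simp

lemma laplacian_radial (g h : ℝ → ℝ) (hp : ℝ) (φ : EuclideanSpace ℝ (Fin N) → ℝ) (x : EuclideanSpace ℝ (Fin N)) (hx : x ≠ 0)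
    (hg : ∀ᶠ y in nhds x, HasDerivAt g (g ‖y‖ * h ‖y‖ / ‖y‖) ‖y‖)
    (hh : HasDerivAt h (hp / ‖x‖) ‖x‖)
    (hφ : ∀ y : EuclideanSpace ℝ (Fin N), y ≠ 0 → φ y = g ‖y‖) :
    euclideanLaplacian φ x
      = φ x / ‖x‖ ^ 2 * (h ‖x‖ ^ 2 + hp + ((N : ℝ) - 2) * h ‖x‖) := by
  have hr : ‖x‖ ≠ 0 := norm_ne_zero_iff.2 hx
  have hne : ∀ᶠ y in nhds x, y ≠ 0 := isOpen_ne.mem_nhds hx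
  have key : ∀ᶠ y in nhds x,
      HasFDerivAt φ ((φ y * h ‖y‖ * ‖y‖ ^ (-2 : ℤ)) • innerSL ℝ y) y := by
    filter_upwards [hg, hne] with y hy hy0
    have hyr : ‖y‖ ≠ 0 := norm_ne_zero_iff.2 hy0
    have h1 := hy.comp_hasFDerivAt y (norm_hasFDerivAt' y hy0)
    have h2 : φ =ᶠ[nhds y] (g ∘ fun y => ‖y‖) := by
      filter_upwards [isOpen_ne.mem_nhds hy0] with z hz using hφ z hz
    refine (h1.congr_of_eventuallyEq h2).congr_fderiv ?_
    rw [hφ y hy0, smul_smul]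
    congr 1
    simp only [zpow_neg]
    field_simp
  have hφx := key.self_of_nhds
  have hH : HasFDerivAt (fun y : EuclideanSpace ℝ (Fin N) => h ‖y‖) ((hp / ‖x‖ ^ 2) • innerSL ℝ x) x := by
    have := hh.comp_hasFDerivAt x (norm_hasFDerivAt' x hx)
    refine this.congr_fderiv ?_
    rw [smul_smul]; congr 1; field_simp
  have hZ : HasFDerivAt (fun y : EuclideanSpace ℝ (Fin N) => ‖y‖ ^ (-2 : ℤ))
      ((-2 * ‖x‖ ^ (-4 : ℤ)) • innerSL ℝ x) x := by
    have := (hasDerivAt_zpow (-2) ‖x‖ (Or.inl hr)).comp_hasFDerivAt x (norm_hasFDerivAt' x hx)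
    refine this.congr_fderiv ?_
    rw [smul_smul]; congr 1
    have : (-4 : ℤ) = (-2 - 1) - 1 := by norm_num
    rw [this, zpow_sub_one₀ hr (-2 - 1)]
    push_cast
    ring
  have hterm : ∀ i : Fin N,
      fderiv ℝ (fun y => fderiv ℝ φ y (EuclideanSpace.single i (1 : ℝ))) x
        (EuclideanSpace.single i (1 : ℝ))
      = φ x / ‖x‖ ^ 2 * ((h ‖x‖ ^ 2 + hp - 2 * h ‖x‖) * (x i ^ 2 / ‖x‖ ^ 2) + h ‖x‖) := by
    intro i
    have e1 : (fun y => fderiv ℝ φ y (EuclideanSpace.single i (1 : ℝ))) =ᶠ[nhds x]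
        fun y => φ y * h ‖y‖ * ‖y‖ ^ (-2 : ℤ) * y i := by
      filter_upwards [key] with y hy
      rw [hy.fderiv]
      simp [EuclideanSpace.inner_single_right]
    have hi : HasFDerivAt (fun y : EuclideanSpace ℝ (Fin N) => y i) (EuclideanSpace.proj i : EuclideanSpace ℝ (Fin N) →L[ℝ] ℝ) x :=
      (EuclideanSpace.proj i : EuclideanSpace ℝ (Fin N) →L[ℝ] ℝ).hasFDerivAt
    have := (((hφx.fun_mul hH).fun_mul hZ).fun_mul hi)
    rw [e1.fderiv_eq, HasFDerivAt.fderiv this]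
    have e4 : ‖x‖ ^ (-4 : ℤ) = 1 / ‖x‖ ^ 4 := by rw [zpow_neg, one_div]; norm_cast
    have e2 : ‖x‖ ^ (-2 : ℤ) = 1 / ‖x‖ ^ 2 := by rw [zpow_neg, one_div]; norm_cast
    simp [EuclideanSpace.inner_single_right, e2, e4]
    field_simp
    ring
  unfold euclideanLaplacian
  rw [Finset.sum_congr rfl fun i _ => hterm i, ← Finset.mul_sum, Finset.sum_add_distrib,
    ← Finset.mul_sum, ← Finset.sum_div, ← EuclideanSpace.real_norm_sq_eq]
  simp
  field_simp
  left
  ring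

lemma norm_gradient_sq (f : EuclideanSpace ℝ (Fin N) → ℝ) (x : EuclideanSpace ℝ (Fin N)) :
    ‖gradient f x‖ ^ 2 = ∑ i : Fin N, (fderiv ℝ f x (EuclideanSpace.single i (1 : ℝ))) ^ 2 := by
  rw [EuclideanSpace.real_norm_sq_eq]
  refine Finset.sum_congr rfl fun i _ => ?_
  congr 1
  have : inner ℝ (gradient f x) (EuclideanSpace.single i (1 : ℝ))
      = fderiv ℝ f x (EuclideanSpace.single i (1 : ℝ)) := by
    simp only [gradient, InnerProductSpace.toDual_symm_apply]
  rw [← this, EuclideanSpace.inner_single_right]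
  simp

lemma integral_fderiv_zero (G : EuclideanSpace ℝ (Fin N) → ℝ) (hG : ContDiff ℝ 1 G) (hc : HasCompactSupport G)
    (v : EuclideanSpace ℝ (Fin N)) : Integrable (fun x => fderiv ℝ G x v) ∧ ∫ x, fderiv ℝ G x v = 0 := by
  have hint : Integrable (fun x => fderiv ℝ G x v) :=
    ((hG.continuous_fderiv one_ne_zero).clm_apply continuous_const).integrable_of_hasCompactSupport
      (hc.fderiv_apply ℝ v)
  refine ⟨hint, ?_⟩
  have := integral_mul_fderiv_eq_neg_fderiv_mul_of_integrable (μ := volume) (𝕜 := ℝ)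
    (f := fun _ : EuclideanSpace ℝ (Fin N) => (1 : ℝ)) (g := G) (v := v) (by simp) (by simpa using hint)
    (by simpa using hG.continuous.integrable_of_hasCompactSupport hc)
    (fun x _ => differentiableAt_const _) (fun x _ => hG.differentiable one_ne_zero x)
  simpa using this

/-- Products with a function supported in an open set of smoothness are smooth. -/
lemma contDiff_mul_of_tsupport {n : WithTop ℕ∞} (w g : EuclideanSpace ℝ (Fin N) → ℝ) (U : Set (EuclideanSpace ℝ (Fin N))) (hw : ContDiff ℝ n w)
    (hg : ∀ x ∈ U, ContDiffAt ℝ n g x) (hs : tsupport w ⊆ U) :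
    ContDiff ℝ n (fun x => w x * g x) := by
  rw [contDiff_iff_contDiffAt]
  intro x
  by_cases hx : x ∈ tsupport w
  · exact hw.contDiffAt.mul (hg x (hs hx))
  · have : (fun x => w x * g x) =ᶠ[nhds x] fun _ => 0 := by
      filter_upwards [(isClosed_tsupport w).isOpen_compl.mem_nhds hx] with y hy
      rw [image_eq_zero_of_notMem_tsupport hy, zero_mul]
    exact contDiffAt_const.congr_of_eventuallyEq this

lemma ground_state_identity (Ω : Set (EuclideanSpace ℝ (Fin N))) (φ V w : EuclideanSpace ℝ (Fin N) → ℝ) (hΩ : IsOpen Ω)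
    (hφ : ∀ x ∈ Ω \ {0}, ContDiffAt ℝ (⊤ : ℕ∞) φ x)
    (heq : ∀ x ∈ Ω, x ≠ 0 → euclideanLaplacian φ x + V x * φ x = 0)
    (hw : ContDiff ℝ (⊤ : ℕ∞) w) (hc : HasCompactSupport w) (hs : tsupport w ⊆ Ω \ {0}) :
    (∫ x in Ω, (‖gradient (fun y => φ y * w y) x‖ ^ 2 - V x * (φ x * w x) ^ 2))
        = ∫ x in Ω, ‖gradient w x‖ ^ 2 * φ x ^ 2 := by
  set e : Fin N → EuclideanSpace ℝ (Fin N) := fun i => EuclideanSpace.single i (1 : ℝ) with he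
  have hφ' : ∀ i, ∀ x ∈ Ω \ {0}, ContDiffAt ℝ (⊤ : ℕ∞) (fun y => fderiv ℝ φ y (e i)) x := by
    intro i x hx
    exact ((hφ x hx).fderiv_right (m := (⊤ : ℕ∞)) (by norm_cast)).clm_apply contDiffAt_const
  set G : Fin N → EuclideanSpace ℝ (Fin N) → ℝ := fun i x => w x * (w x * (φ x * fderiv ℝ φ x (e i))) with hG
  have hGs : ∀ i, ContDiff ℝ (⊤ : ℕ∞) (G i) := fun i =>
    contDiff_mul_of_tsupport w _ _ hw
      (fun x hx => hw.contDiffAt.mul ((hφ x hx).mul (hφ' i x hx))) hs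
  have hGc : ∀ i, HasCompactSupport (G i) := fun i => hc.mul_right
  have hGi := fun i => integral_fderiv_zero (G i) ((hGs i).of_le (by norm_cast)) (hGc i) (e i)
  have hbs : ∀ i, ContDiff ℝ (⊤ : ℕ∞) (fun x => fderiv ℝ w x (e i) * φ x) := fun i =>
    contDiff_mul_of_tsupport _ _ (Ω \ {0})
      ((hw.fderiv_right (m := (⊤ : ℕ∞)) (by norm_cast)).clm_apply contDiff_const) hφ
      ((tsupport_fderiv_apply_subset ℝ (e i)).trans hs)
  have hbi : ∀ i, Integrable (fun x => (fderiv ℝ w x (e i) * φ x) ^ 2) := by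
    intro i
    refine ((hbs i).continuous.pow 2).integrable_of_hasCompactSupport ?_
    have h1 : HasCompactSupport (fun x => fderiv ℝ w x (e i) * φ x) :=
      (hc.fderiv_apply ℝ (e i)).mul_right
    simp only [pow_two]
    exact h1.mul_right
  -- off the support
  have hoff : ∀ x, x ∉ tsupport w → (∀ v, fderiv ℝ w x v = 0) ∧ (∀ i, fderiv ℝ (G i) x = 0) ∧
      fderiv ℝ (fun y => φ y * w y) x = 0 ∧ w x = 0 := by
    intro x hx
    have h0 : ∀ᶠ y in nhds x, w y = 0 := by
      filter_upwards [(isClosed_tsupport w).isOpen_compl.mem_nhds hx] with y hy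
      exact image_eq_zero_of_notMem_tsupport hy
    have aux : ∀ f : EuclideanSpace ℝ (Fin N) → ℝ, (∀ᶠ y in nhds x, f y = 0) → fderiv ℝ f x = 0 := by
      intro f hf
      have : f =ᶠ[nhds x] fun _ => 0 := hf
      rw [this.fderiv_eq]; simp
    refine ⟨fun v => by rw [aux w h0]; simp, fun i => aux _ ?_, aux _ ?_, h0.self_of_nhds⟩
    · filter_upwards [h0] with y hy
      simp [hG, hy]
    · filter_upwards [h0] with y hy
      simp [hy]
  have hpt : ∀ x, ‖gradient (fun y => φ y * w y) x‖ ^ 2 - V x * (φ x * w x) ^ 2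
      = (∑ i, (fderiv ℝ w x (e i) * φ x) ^ 2) + ∑ i, fderiv ℝ (G i) x (e i) := by
    intro x
    by_cases hx : x ∈ tsupport w
    · have hxU := hs hx
      have hlap := heq x hxU.1 hxU.2
      have hdφ := ((hφ x hxU).differentiableAt (by simp)).hasFDerivAt
      have hdw := (hw.differentiable (by simp) x).hasFDerivAt
      have hdG : ∀ i, fderiv ℝ (G i) x (e i) =
          2 * w x * fderiv ℝ w x (e i) * φ x * fderiv ℝ φ x (e i)
          + w x ^ 2 * (fderiv ℝ φ x (e i)) ^ 2
          + w x ^ 2 * φ x * fderiv ℝ (fun y => fderiv ℝ φ y (e i)) x (e i) := by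
        intro i
        have hd2 := ((hφ' i x hxU).differentiableAt (by simp)).hasFDerivAt
        have := hdw.fun_mul (hdw.fun_mul (hdφ.fun_mul hd2))
        have h2 : fderiv ℝ (G i) x = _ := HasFDerivAt.fderiv this
        rw [h2]
        simp
        ring
      have hV : V x * (φ x * w x) ^ 2 = - (w x ^ 2 * φ x * euclideanLaplacian φ x) := by
        linear_combination (φ x * w x ^ 2) * hlap
      rw [norm_gradient_sq, hV, (hdφ.fun_mul hdw).fderiv, sub_neg_eq_add]
      unfold euclideanLaplacian
      rw [Finset.mul_sum, ← Finset.sum_add_distrib, ← Finset.sum_add_distrib]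
      refine Finset.sum_congr rfl fun i _ => ?_
      rw [hdG i]
      simp [he]
      ring
    · obtain ⟨h1, h2, h3, h4⟩ := hoff x hx
      rw [norm_gradient_sq, h3]
      simp [h1, h2, h4]
  have hrhs : ∀ x, ‖gradient w x‖ ^ 2 * φ x ^ 2 = ∑ i, (fderiv ℝ w x (e i) * φ x) ^ 2 := by
    intro x
    rw [norm_gradient_sq, Finset.sum_mul]
    simp [mul_pow, he]
  have hnot : ∀ x, x ∉ Ω → x ∉ tsupport w := fun x hx hx' => hx (hs hx').1
  simp only [hpt, hrhs]
  rw [setIntegral_eq_integral_of_forall_compl_eq_zero, setIntegral_eq_integral_of_forall_compl_eq_zero,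
    integral_add (integrable_finsetSum _ fun i _ => hbi i)
      (integrable_finsetSum _ fun i _ => (hGi i).1),
    integral_finsetSum (f := fun i x => fderiv ℝ (G i) x (e i)) _ fun i _ => (hGi i).1]
  · simp [fun i => (hGi i).2]
  · intro x hx
    simp [(hoff x (hnot x hx)).1]
  · intro x hx
    simp [(hoff x (hnot x hx)).1, (hoff x (hnot x hx)).2.1]

end Euclid

/-- φ_{k,β} is a ground state: Δφ_{k,β} + V_k^μ φ_{k,β} = 0 on
Ω∖{0}, and consequently the ground state substitution u = φ_{k,β} w turns the
quadratic form of -Δ - V_k^μ into ∫ |∇w|² φ_{k,β}². -/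
theorem ground_state_log_refined (N : ℕ) (hN : 3 ≤ N) (k : ℕ) (hk : 1 ≤ k)
    (μ β D : ℝ) (hμ0 : 0 < μ) (hμ : μ ≤ 1 / 4)
    (hβroot : β * (1 - β) = μ) (hβ : 1 / 2 ≤ β)
    (Ω : Set (EuclideanSpace ℝ (Fin N)))
    (hΩo : IsOpen Ω) (hΩc : IsConnected Ω) (hΩb : Bornology.IsBounded Ω)
    (h0 : (0 : EuclideanSpace ℝ (Fin N)) ∈ Ω)
    (hD : IsLUB ((fun x : EuclideanSpace ℝ (Fin N) => ‖x‖) '' Ω) D)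
    (φ V : EuclideanSpace ℝ (Fin N) → ℝ)
    (hφ : ∀ x : EuclideanSpace ℝ (Fin N), x ≠ 0 →
      φ x = ‖x‖ ^ (-(((N : ℝ) - 2) / 2))
        * (∏ i ∈ Finset.Icc 1 (k - 1), iterX i (‖x‖ / D) ^ (-(1 : ℝ) / 2))
        * iterX k (‖x‖ / D) ^ (-β))
    (hV : ∀ x : EuclideanSpace ℝ (Fin N), x ≠ 0 →
      V x = (((N : ℝ) - 2) / 2) ^ 2 / ‖x‖ ^ 2
        + (1 / (4 * ‖x‖ ^ 2))
            * ∑ i ∈ Finset.Icc 1 (k - 1), ∏ j ∈ Finset.Icc 1 i, iterX j (‖x‖ / D) ^ 2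
        + (μ / ‖x‖ ^ 2) * ∏ j ∈ Finset.Icc 1 k, iterX j (‖x‖ / D) ^ 2) :
    (∀ x ∈ Ω, x ≠ (0 : EuclideanSpace ℝ (Fin N)) →
      euclideanLaplacian φ x + V x * φ x = 0) ∧
    (∀ w : EuclideanSpace ℝ (Fin N) → ℝ,
      ContDiff ℝ (⊤ : ℕ∞) w → HasCompactSupport w →
      tsupport w ⊆ Ω \ {0} →
      (∫ x in Ω, (‖gradient (fun y => φ y * w y) x‖ ^ 2 - V x * (φ x * w x) ^ 2))
        = ∫ x in Ω, ‖gradient w x‖ ^ 2 * φ x ^ 2) := by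
  obtain ⟨n, rfl⟩ : ∃ n, k = n + 1 := ⟨k - 1, by omega⟩
  simp only [Nat.add_sub_cancel] at hφ hV
  -- strict bound on Ω minus the origin
  have hlt : ∀ x ∈ Ω, ‖x‖ < D := by
    have hle : ∀ y ∈ Ω, ‖y‖ ≤ D := fun y hy => hD.1 ⟨y, hy, rfl⟩
    intro x hx
    rcases (hle x hx).lt_or_eq with h | h
    · exact h
    exfalso
    haveI : Nonempty (Fin N) := ⟨⟨0, by omega⟩⟩
    by_cases hx0 : x = 0
    · obtain ⟨ε, hε, hb⟩ := Metric.isOpen_iff.1 hΩo x hx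
      subst hx0
      have hm : EuclideanSpace.single (⟨0, by omega⟩ : Fin N) (ε / 2) ∈ Ω := by
        apply hb
        simp [abs_of_pos hε]
        linarith
      have := hle _ hm
      simp [abs_of_pos hε] at this
      simp at h
      linarith
    · have hc : Filter.Tendsto (fun t : ℝ => t • x) (nhds 1) (nhds x) := by
        have : Continuous (fun t : ℝ => t • x) := by fun_prop
        simpa using this.tendsto 1
      have hev := hc.eventually (hΩo.mem_nhds hx)
      obtain ⟨ε, hε, hb⟩ := Metric.eventually_nhds_iff.1 hev
      have hm : (1 + ε / 2) • x ∈ Ω := by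
        apply hb
        simp [Real.dist_eq, abs_of_pos hε]
        linarith
      have h2 := hle _ hm
      rw [norm_smul, Real.norm_eq_abs, abs_of_pos (by linarith), h] at h2
      have : 0 < D := h ▸ norm_pos_iff.2 hx0
      nlinarith
  have hbd : ∀ x ∈ Ω, x ≠ 0 → 0 < ‖x‖ ∧ 0 < ‖x‖ / D ∧ ‖x‖ / D < 1 := by
    intro x hx hx0
    have h1 : 0 < ‖x‖ := norm_pos_iff.2 hx0
    have h2 := hlt x hx
    have h3 : 0 < D := h1.trans h2
    exact ⟨h1, div_pos h1 h3, (div_lt_one h3).2 h2⟩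
  have hφ' : ∀ x, x ≠ 0 → φ x = gsG (((N : ℝ) - 2) / 2) β D n ‖x‖ := fun x hx => hφ x hx
  have heq : ∀ x ∈ Ω, x ≠ (0 : EuclideanSpace ℝ (Fin N)) →
      euclideanLaplacian φ x + V x * φ x = 0 := by
    intro x hx hx0
    obtain ⟨h1, h2, h3⟩ := hbd x hx hx0
    rw [laplacian_radial _ _ _ φ x hx0 ?_ (gsH_hasDerivAt (((N : ℝ) - 2) / 2) β D n ‖x‖ h1 h2 h3)
      hφ', hV x hx0]
    · simp only [gsP, Finset.prod_pow, hβroot]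
      field_simp
      ring
    · filter_upwards [hΩo.mem_nhds hx, isOpen_ne.mem_nhds hx0] with y hy hy0
      obtain ⟨g1, g2, g3⟩ := hbd y hy hy0
      exact gsG_hasDerivAt _ _ _ _ _ g1 g2 g3
  refine ⟨heq, fun w hw hc hs => ground_state_identity Ω φ V w hΩo ?_ heq hw hc hs⟩
  intro x hx
  obtain ⟨h1, h2, h3⟩ := hbd x hx.1 hx.2
  have hcd := (gsG_contDiffAt (((N : ℝ) - 2) / 2) β D n ‖x‖ h1 h2 h3).comp x
    (contDiffAt_norm ℝ (show x ≠ 0 from hx.2))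
  refine hcd.congr_of_eventuallyEq ?_
  filter_upwards [isOpen_ne.mem_nhds hx.2] with y hy using hφ' y hy
end
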